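/- arXiv:1702.04745 — 3 statements merged into one kernel-verified Lean document; each statement's English description precedes it below -/
import Mathlib

section
/- For n ≥ 1, let H_n be the random variable 'total height' (sum over all vertices of the distance to the root) on the set of complete binary trees with 2n+1 vertices, equipped with the uniform distribution. Let μ(n) = E[H_n], m_i(n) = E[(H_n − μ(n))^i], and α_i(n) = m_i(n)/m_2(n)^{i/2}. Then the limit of the skewness exists and lim_{n→∞} α_3(n) = (6π − 75/4)·√3·√(π/(10 − 3π)) / (10 − 3π) ≈ 0.70056652935965…. -/
inductive PTree : Type
  | node : List PTree → PTree

namespace PTree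

/-- Number of vertices of an ordered rooted (plane) tree. -/
def size : PTree → ℕ
  | node ts => 1 + (ts.attach.map fun t => size t.1).sum
decreasing_by
  have := List.sizeOf_lt_of_mem t.2
  simp only [PTree.node.sizeOf_spec]
  omega

/-- Total height: sum over all vertices of the distance to the root. -/
def totalHeight : PTree → ℕ
  | node ts => (ts.attach.map fun t => totalHeight t.1 + size t.1).sum
decreasing_by
  have := List.sizeOf_lt_of_mem t.2
  simp only [PTree.node.sizeOf_spec]
  omega

/-- Every vertex has no children, or a number of children belonging to `S`. -/
def validDeg (S : Finset ℕ) : PTree → Prop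
  | node ts => (ts = [] ∨ ts.length ∈ S) ∧ ∀ t ∈ ts, validDeg S t
decreasing_by
  have := List.sizeOf_lt_of_mem (by assumption : t ∈ ts)
  simp only [PTree.node.sizeOf_spec]
  omega

end PTree


namespace TH

open PowerSeries Finset

/-! ### Trees -/

lemma size_node (ts : List PTree) : (PTree.node ts).size = 1 + (ts.map PTree.size).sum := by
  rw [PTree.size, List.attach_map_val (f := PTree.size)]

lemma height_node (ts : List PTree) : (PTree.node ts).totalHeight =
    (ts.map fun t => PTree.totalHeight t + PTree.size t).sum := by
  rw [PTree.totalHeight, List.attach_map_val (f := fun t => PTree.totalHeight t + PTree.size t)]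

lemma valid_node (S : Finset ℕ) (ts : List PTree) : (PTree.node ts).validDeg S ↔
    (ts = [] ∨ ts.length ∈ S) ∧ ∀ t ∈ ts, PTree.validDeg S t := by
  rw [PTree.validDeg]

lemma valid_cases (t : PTree) (h : t.validDeg {2}) :
    t = PTree.node [] ∨ ∃ l r, t = PTree.node [l, r] ∧ l.validDeg {2} ∧ r.validDeg {2} := by
  obtain ⟨ts⟩ := t
  rw [valid_node] at h
  obtain ⟨h1 | h1, h2⟩ := h
  · left; rw [h1]
  · right
    rw [Finset.mem_singleton, List.length_eq_two] at h1
    obtain ⟨l, r, rfl⟩ := h1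
    exact ⟨l, r, rfl, h2 l (by simp), h2 r (by simp)⟩

lemma valid_pair (l r : PTree) (hl : l.validDeg {2}) (hr : r.validDeg {2}) :
    (PTree.node [l, r]).validDeg {2} := by
  rw [valid_node]
  refine ⟨Or.inr (by simp), ?_⟩
  intro t ht
  simp only [List.mem_cons, List.not_mem_nil, or_false] at ht
  rcases ht with rfl | rfl <;> assumption

lemma valid_leaf : (PTree.node []).validDeg {2} := by
  rw [valid_node]; simp

lemma size_pair (l r : PTree) : (PTree.node [l, r]).size = 1 + (l.size + r.size) := by
  rw [size_node]; simp

lemma size_leaf : (PTree.node []).size = 1 := by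
  rw [size_node]; simp

lemma height_leaf : (PTree.node []).totalHeight = 0 := by
  rw [height_node]; simp

lemma height_pair (l r : PTree) : (PTree.node [l, r]).totalHeight =
    l.totalHeight + r.totalHeight + (l.size + r.size) := by
  rw [height_node]; simp; ring

lemma size_pos (t : PTree) : 0 < t.size := by
  obtain ⟨ts⟩ := t
  rw [size_node]; omega

lemma size_odd (k : ℕ) : ∀ t : PTree, t.size ≤ k → t.validDeg {2} →
    ∃ n, t.size = 2 * n + 1 := by
  induction k with
  | zero => intro t h; have := size_pos t; omega
  | succ k ih =>
    intro t h hv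
    rcases valid_cases t hv with rfl | ⟨l, r, rfl, hl, hr⟩
    · exact ⟨0, size_leaf⟩
    · rw [size_pair] at h ⊢
      have := size_pos l
      have := size_pos r
      obtain ⟨a, ha⟩ := ih l (by omega) hl
      obtain ⟨b, hb⟩ := ih r (by omega) hr
      exact ⟨a + b + 1, by omega⟩

lemma sum_succ (T : ℕ → Finset PTree)
    (hT : ∀ n : ℕ, ∀ t : PTree, t ∈ T n ↔ t.size = 2 * n + 1 ∧ t.validDeg {2})
    (φ : PTree → ℝ) (n : ℕ) :
    ∑ t ∈ T (n + 1), φ t =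
      ∑ p ∈ antidiagonal n, ∑ l ∈ T p.1, ∑ r ∈ T p.2, φ (PTree.node [l, r]) := by
  simp_rw [← Finset.sum_product']
  rw [Finset.sum_sigma']
  symm
  refine Finset.sum_bij (fun x _ => PTree.node [x.2.1, x.2.2]) ?_ ?_ ?_ ?_
  · rintro ⟨⟨a, b⟩, l, r⟩ h
    simp only [mem_sigma, HasAntidiagonal.mem_antidiagonal, mem_product, hT] at h ⊢
    obtain ⟨h1, ⟨h2, h3⟩, h4, h5⟩ := h
    refine ⟨?_, valid_pair _ _ h3 h5⟩
    rw [size_pair]; omega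
  · rintro ⟨⟨a, b⟩, l, r⟩ h ⟨⟨a', b'⟩, l', r'⟩ h' he
    simp only [mem_sigma, HasAntidiagonal.mem_antidiagonal, mem_product, hT] at h h'
    simp only [PTree.node.injEq, List.cons.injEq, and_true] at he
    obtain ⟨rfl, rfl⟩ := he
    obtain rfl : a = a' := by omega
    obtain rfl : b = b' := by omega
    rfl
  · intro t ht
    rw [hT] at ht
    rcases valid_cases t ht.2 with rfl | ⟨l, r, rfl, hl, hr⟩
    · have := ht.1; rw [size_leaf] at this; omega
    · obtain ⟨a, ha⟩ := size_odd _ l le_rfl hl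
      obtain ⟨b, hb⟩ := size_odd _ r le_rfl hr
      have h1 := ht.1
      rw [size_pair] at h1
      refine ⟨⟨(a, b), l, r⟩, ?_, rfl⟩
      simp only [mem_sigma, HasAntidiagonal.mem_antidiagonal, mem_product, hT]
      exact ⟨by omega, ⟨ha, hl⟩, hb, hr⟩
  · intros; rfl

lemma T_zero (T : ℕ → Finset PTree)
    (hT : ∀ n : ℕ, ∀ t : PTree, t ∈ T n ↔ t.size = 2 * n + 1 ∧ t.validDeg {2}) :
    T 0 = {PTree.node []} := by
  ext t
  rw [hT, Finset.mem_singleton]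
  constructor
  · rintro ⟨h1, h2⟩
    rcases valid_cases t h2 with rfl | ⟨l, r, rfl, hl, hr⟩
    · rfl
    · rw [size_pair] at h1
      have := size_pos l
      omega
  · rintro rfl
    exact ⟨size_leaf, valid_leaf⟩

/-- Power sums of the total height. -/
noncomputable def M (T : ℕ → Finset PTree) (k n : ℕ) : ℝ :=
  ∑ t ∈ T n, (t.totalHeight : ℝ) ^ k

/-- Shifted generating function of the power sums. -/
noncomputable def f (T : ℕ → Finset PTree) (k : ℕ) : ℝ⟦X⟧ := X * PowerSeries.mk (M T k)

lemma coeff_f (T : ℕ → Finset PTree) (k n : ℕ) : coeff (n + 1) (f T k) = M T k n := by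
  rw [f, PowerSeries.coeff_succ_X_mul, coeff_mk]

lemma coeff_one_f (T : ℕ → Finset PTree) (k : ℕ) : coeff 1 (f T k) = M T k 0 := coeff_f T k 0

lemma coeff_zero_f (T : ℕ → Finset PTree) (k : ℕ) : coeff 0 (f T k) = 0 := by
  simp [f]

lemma coeff_ff (T : ℕ → Finset PTree) (i j n : ℕ) : coeff (n + 2) (f T i * f T j) =
    ∑ p ∈ antidiagonal n, M T i p.1 * M T j p.2 := by
  have : f T i * f T j = X * (X * (PowerSeries.mk (M T i) * PowerSeries.mk (M T j))) := by
    unfold f; ring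
  rw [this, PowerSeries.coeff_succ_X_mul, PowerSeries.coeff_succ_X_mul, coeff_mul]
  simp

lemma coeff_ff_zero (T : ℕ → Finset PTree) (i j : ℕ) : coeff 0 (f T i * f T j) = 0 := by
  simp [f]

lemma coeff_ff_one (T : ℕ → Finset PTree) (i j : ℕ) : coeff 1 (f T i * f T j) = 0 := by
  have : f T i * f T j = X * (X * (PowerSeries.mk (M T i) * PowerSeries.mk (M T j))) := by
    unfold f; ring
  rw [this, show (1 : ℕ) = 0 + 1 from rfl, PowerSeries.coeff_succ_X_mul]
  simp

/-- The Euler operator. -/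
noncomputable def θ : Derivation ℝ ℝ⟦X⟧ ℝ⟦X⟧ := (X : ℝ⟦X⟧) • PowerSeries.derivative ℝ

lemma coeff_θ (g : ℝ⟦X⟧) (n : ℕ) : coeff n (θ g) = n * coeff n g := by
  have : θ g = X * PowerSeries.derivative ℝ g := by
    simp [θ]
  rw [this]
  cases n with
  | zero => simp
  | succ n => rw [PowerSeries.coeff_succ_X_mul, PowerSeries.coeff_derivative]; push_cast; ring

/-- Euler operator minus one. -/
noncomputable def E : ℝ⟦X⟧ →ₗ[ℝ] ℝ⟦X⟧ := θ.toLinearMap - LinearMap.id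

lemma E_apply (g : ℝ⟦X⟧) : E g = θ g - g := by
  simp [E]

lemma coeff_E (g : ℝ⟦X⟧) (n : ℕ) : coeff n (E g) = (n - 1) * coeff n g := by
  rw [E_apply, map_sub, coeff_θ]; ring

lemma two_mul_E (c : ℕ) (g : ℝ⟦X⟧) : E ((c : ℝ⟦X⟧) * g) = (c : ℝ⟦X⟧) * E g := by
  rw [← nsmul_eq_mul, ← nsmul_eq_mul, map_nsmul]

lemma M_zero (T : ℕ → Finset PTree)
    (hT : ∀ n : ℕ, ∀ t : PTree, t ∈ T n ↔ t.size = 2 * n + 1 ∧ t.validDeg {2}) (k : ℕ) :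
    M T k 0 = 0 ^ k := by
  simp [M, T_zero T hT, height_leaf]

lemma M_succ (T : ℕ → Finset PTree)
    (hT : ∀ n : ℕ, ∀ t : PTree, t ∈ T n ↔ t.size = 2 * n + 1 ∧ t.validDeg {2}) (k n : ℕ) :
    M T k (n + 1) = ∑ p ∈ antidiagonal n, ∑ l ∈ T p.1, ∑ r ∈ T p.2,
      ((l.totalHeight : ℝ) + r.totalHeight + 2 * (n + 1)) ^ k := by
  rw [M, sum_succ T hT]
  refine Finset.sum_congr rfl fun p hp => Finset.sum_congr rfl fun l hl =>
    Finset.sum_congr rfl fun r hr => ?_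
  rw [HasAntidiagonal.mem_antidiagonal] at hp
  rw [hT] at hl hr
  have : l.size + r.size = 2 * (n + 1) := by omega
  rw [height_pair, this]
  push_cast
  rfl

lemma MM (T : ℕ → Finset PTree) (i j a b : ℕ) : M T i a * M T j b =
    ∑ l ∈ T a, ∑ r ∈ T b, (l.totalHeight : ℝ) ^ i * (r.totalHeight : ℝ) ^ j := by
  rw [M, M, Finset.sum_mul_sum]

lemma eq0 (T : ℕ → Finset PTree)
    (hT : ∀ n : ℕ, ∀ t : PTree, t ∈ T n ↔ t.size = 2 * n + 1 ∧ t.validDeg {2}) : f T 0 = X + f T 0 * f T 0 := by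
  ext n
  match n with
  | 0 => rw [map_add, coeff_ff_zero, coeff_zero_f]; simp
  | 1 => rw [map_add, coeff_ff_one, coeff_one_f, M_zero T hT]; simp
  | n + 2 =>
    rw [map_add, coeff_ff, coeff_f, M_succ T hT]
    simp [MM, coeff_X]

lemma eq1 (T : ℕ → Finset PTree)
    (hT : ∀ n : ℕ, ∀ t : PTree, t ∈ T n ↔ t.size = 2 * n + 1 ∧ t.validDeg {2}) : f T 1 = 2 * E (f T 0 * f T 0) + 2 * (f T 0 * f T 1) := by
  have h2 (g : ℝ⟦X⟧) (n : ℕ) : coeff n (2 * g) = 2 * coeff n g := by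
    rw [two_mul, two_mul, map_add]
  ext n
  simp only [map_add, h2, coeff_E]
  match n with
  | 0 => simp only [coeff_ff_zero, coeff_zero_f]; simp
  | 1 => simp only [coeff_ff_one]; rw [coeff_one_f, M_zero T hT]; simp
  | n + 2 =>
    simp only [coeff_ff]
    rw [coeff_f, M_succ T hT]
    have hs : ∑ p ∈ antidiagonal n, M T 0 p.1 * M T 1 p.2 =
      ∑ p ∈ antidiagonal n, M T 1 p.1 * M T 0 p.2 := by
      rw [← Finset.Nat.sum_antidiagonal_swap]
      simp [mul_comm]
    rw [two_mul (∑ p ∈ antidiagonal n, M T 0 p.1 * M T 1 p.2)]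
    nth_rw 2 [hs]
    simp only [MM, Finset.mul_sum, ← Finset.sum_add_distrib]
    refine Finset.sum_congr rfl fun p hp => Finset.sum_congr rfl fun l hl =>
      Finset.sum_congr rfl fun r hr => ?_
    push_cast
    ring

lemma eq2 (T : ℕ → Finset PTree)
    (hT : ∀ n : ℕ, ∀ t : PTree, t ∈ T n ↔ t.size = 2 * n + 1 ∧ t.validDeg {2}) : f T 2 = 4 * E (E (f T 0 * f T 0)) + 4 * E (2 * (f T 0 * f T 1))
    + (2 * (f T 0 * f T 2) + 2 * (f T 1 * f T 1)) := by
  have h2 (g : ℝ⟦X⟧) (n : ℕ) : coeff n (2 * g) = 2 * coeff n g := by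
    rw [two_mul, two_mul, map_add]
  have h4 (g : ℝ⟦X⟧) (n : ℕ) : coeff n (4 * g) = 4 * coeff n g := by
    rw [show (4 : ℝ⟦X⟧) * g = 2 * (2 * g) by ring, h2, h2]; ring
  ext n
  simp only [map_add, h2, h4, coeff_E]
  match n with
  | 0 => simp only [coeff_ff_zero, coeff_zero_f]; simp
  | 1 => simp only [coeff_ff_one]; rw [coeff_one_f, M_zero T hT]; simp
  | n + 2 =>
    simp only [coeff_ff]
    rw [coeff_f, M_succ T hT]
    have hs (i : ℕ) : ∑ p ∈ antidiagonal n, M T 0 p.1 * M T i p.2 =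
      ∑ p ∈ antidiagonal n, M T i p.1 * M T 0 p.2 := by
      rw [← Finset.Nat.sum_antidiagonal_swap]
      simp [mul_comm]
    have hs' (i : ℕ) : 2 * ∑ p ∈ antidiagonal n, M T 0 p.1 * M T i p.2 =
      ∑ p ∈ antidiagonal n, M T 0 p.1 * M T i p.2 +
      ∑ p ∈ antidiagonal n, M T i p.1 * M T 0 p.2 := by
      rw [← hs]; ring
    rw [hs', hs']
    simp only [MM, Finset.mul_sum, ← Finset.sum_add_distrib]
    refine Finset.sum_congr rfl fun p hp => Finset.sum_congr rfl fun l hl =>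
      Finset.sum_congr rfl fun r hr => ?_
    push_cast
    ring

lemma eq3 (T : ℕ → Finset PTree)
    (hT : ∀ n : ℕ, ∀ t : PTree, t ∈ T n ↔ t.size = 2 * n + 1 ∧ t.validDeg {2}) : f T 3 = 8 * E (E (E (f T 0 * f T 0))) + 12 * E (E (2 * (f T 0 * f T 1)))
    + 6 * E (2 * (f T 0 * f T 2) + 2 * (f T 1 * f T 1))
    + (2 * (f T 0 * f T 3) + 6 * (f T 1 * f T 2)) := by
  have hc (c : ℕ) (g : ℝ⟦X⟧) (n : ℕ) : coeff n ((c : ℝ⟦X⟧) * g) = c * coeff n g := by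
    rw [← nsmul_eq_mul, ← nsmul_eq_mul, map_nsmul]
  have h2 (g : ℝ⟦X⟧) (n : ℕ) : coeff n (2 * g) = 2 * coeff n g := mod_cast hc 2 g n
  have h6 (g : ℝ⟦X⟧) (n : ℕ) : coeff n (6 * g) = 6 * coeff n g := mod_cast hc 6 g n
  have h8 (g : ℝ⟦X⟧) (n : ℕ) : coeff n (8 * g) = 8 * coeff n g := mod_cast hc 8 g n
  have h12 (g : ℝ⟦X⟧) (n : ℕ) : coeff n (12 * g) = 12 * coeff n g := mod_cast hc 12 g n
  ext n
  simp only [map_add, h2, h6, h8, h12, coeff_E]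
  match n with
  | 0 => simp only [coeff_ff_zero, coeff_zero_f]; simp
  | 1 => simp only [coeff_ff_one]; rw [coeff_one_f, M_zero T hT]; simp
  | n + 2 =>
    simp only [coeff_ff]
    rw [coeff_f, M_succ T hT]
    have hs (i j : ℕ) : ∑ p ∈ antidiagonal n, M T j p.1 * M T i p.2 =
      ∑ p ∈ antidiagonal n, M T i p.1 * M T j p.2 := by
      rw [← Finset.Nat.sum_antidiagonal_swap]
      simp [mul_comm]
    have hs' (i : ℕ) : 2 * ∑ p ∈ antidiagonal n, M T 0 p.1 * M T i p.2 =
      ∑ p ∈ antidiagonal n, M T 0 p.1 * M T i p.2 +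
      ∑ p ∈ antidiagonal n, M T i p.1 * M T 0 p.2 := by
      rw [← hs]; ring
    have hs6 : 6 * ∑ p ∈ antidiagonal n, M T 1 p.1 * M T 2 p.2 =
      3 * ∑ p ∈ antidiagonal n, M T 1 p.1 * M T 2 p.2 +
      3 * ∑ p ∈ antidiagonal n, M T 2 p.1 * M T 1 p.2 := by
      rw [← hs]; ring
    rw [hs', hs', hs', hs6]
    simp only [MM, Finset.mul_sum, ← Finset.sum_add_distrib]
    refine Finset.sum_congr rfl fun p hp => Finset.sum_congr rfl fun l hl =>
      Finset.sum_congr rfl fun r hr => ?_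
    push_cast
    ring


/-! ### Algebra -/

set_option linter.unusedSimpArgs false

lemma E_nat (c : ℕ) (y p : ℝ⟦X⟧) (h : (c : ℝ⟦X⟧) * y = p) : (c : ℝ⟦X⟧) * E y = θ p - p := by
  rw [← h, ← E_apply, two_mul_E]

lemma θ_one : θ (1 : ℝ⟦X⟧) = 0 := Derivation.map_one_eq_zero θ

lemma θ_nat (n : ℕ) : θ (n : ℝ⟦X⟧) = 0 := Derivation.map_natCast θ n

lemma θ_ofNat_mul (n : ℕ) [n.AtLeastTwo] (g : ℝ⟦X⟧) :
    θ ((OfNat.ofNat n : ℝ⟦X⟧) * g) = OfNat.ofNat n * θ g := by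
  have h : (OfNat.ofNat n : ℝ⟦X⟧) = (n : ℝ⟦X⟧) :=
    (Nat.cast_ofNat (R := ℝ⟦X⟧) (n := n)).symm
  rw [h, Derivation.leibniz, θ_nat]; simp

lemma θ_ofNat (n : ℕ) [n.AtLeastTwo] : θ (OfNat.ofNat n : ℝ⟦X⟧) = 0 := by
  have h : (OfNat.ofNat n : ℝ⟦X⟧) = (n : ℝ⟦X⟧) :=
    (Nat.cast_ofNat (R := ℝ⟦X⟧) (n := n)).symm
  rw [h, θ_nat]

lemma θ_mul2 (g : ℝ⟦X⟧) : θ ((2 : ℝ⟦X⟧) * g) = 2 * θ g := by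
  rw [θ_ofNat_mul]

lemma θ_mul3 (g : ℝ⟦X⟧) : θ ((3 : ℝ⟦X⟧) * g) = 3 * θ g := by
  rw [θ_ofNat_mul]

lemma θ_mul4 (g : ℝ⟦X⟧) : θ ((4 : ℝ⟦X⟧) * g) = 4 * θ g := by
  rw [θ_ofNat_mul]

lemma θ_mul5 (g : ℝ⟦X⟧) : θ ((5 : ℝ⟦X⟧) * g) = 5 * θ g := by
  rw [θ_ofNat_mul]

lemma θ_mul10 (g : ℝ⟦X⟧) : θ ((10 : ℝ⟦X⟧) * g) = 10 * θ g := by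
  rw [θ_ofNat_mul]

lemma θ_mul13 (g : ℝ⟦X⟧) : θ ((13 : ℝ⟦X⟧) * g) = 13 * θ g := by
  rw [θ_ofNat_mul]

lemma θ_mul20 (g : ℝ⟦X⟧) : θ ((20 : ℝ⟦X⟧) * g) = 20 * θ g := by
  rw [θ_ofNat_mul]

lemma θ_mul23 (g : ℝ⟦X⟧) : θ ((23 : ℝ⟦X⟧) * g) = 23 * θ g := by
  rw [θ_ofNat_mul]

lemma θ_cst2 : θ (2 : ℝ⟦X⟧) = 0 := by
  rw [θ_ofNat]

lemma θ_cst3 : θ (3 : ℝ⟦X⟧) = 0 := by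
  rw [θ_ofNat]

lemma θ_cst4 : θ (4 : ℝ⟦X⟧) = 0 := by
  rw [θ_ofNat]

lemma θ_cst6 : θ (6 : ℝ⟦X⟧) = 0 := by
  rw [θ_ofNat]

lemma θ_cst9 : θ (9 : ℝ⟦X⟧) = 0 := by
  rw [θ_ofNat]

lemma θ_X : θ (X : ℝ⟦X⟧) = X := by
  simp [θ]

lemma θ_pow (u : ℝ⟦X⟧) (hu : 2 * θ u = u ^ 3 - u) (m : ℕ) :
    2 * θ (u ^ m) = m * (u ^ (m + 2) - u ^ m) := by
  rw [Derivation.leibniz_pow]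
  cases m with
  | zero => simp
  | succ m =>
    simp only [smul_eq_mul, nsmul_eq_mul, Nat.add_sub_cancel]
    linear_combination ((m + 1 : ℕ) : ℝ⟦X⟧) * u ^ m * hu

lemma algebra_core (f0 f1 f2 f3 : ℝ⟦X⟧) (h0 : f0 = X + f0 * f0)
    (h1 : f1 = 2 * E (f0 * f0) + 2 * (f0 * f1))
    (h2 : f2 = 4 * E (E (f0 * f0)) + 4 * E (2 * (f0 * f1)) + (2 * (f0 * f2) + 2 * (f1 * f1)))
    (h3 : f3 = 8 * E (E (E (f0 * f0))) + 12 * E (E (2 * (f0 * f1)))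
      + 6 * E (2 * (f0 * f2) + 2 * (f1 * f1)) + (2 * (f0 * f3) + 6 * (f1 * f2)))
    (hc : constantCoeff f0 = 0) :
    ∃ s u : ℝ⟦X⟧, s * u = 1 ∧ s * s = 1 - 4 * X ∧ constantCoeff u = 1 ∧
      2 * θ s = s - u ∧ 2 * θ u = u ^ 3 - u ∧
      2 * f0 = 1 - s ∧ 2 * f1 = 1 - 2 * u + u ^ 2 ∧
      2 * f2 = 1 - 7 * u + 12 * u ^ 2 - 2 * u ^ 3 - 9 * u ^ 4 + 5 * u ^ 5 ∧
      2 * f3 = 1 - 23 * u + 103 * u ^ 2 - 111 * u ^ 3 - 147 * u ^ 4 + 315 * u ^ 5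
        - 39 * u ^ 6 - 189 * u ^ 7 + 90 * u ^ 8 := by
  obtain ⟨s, hs⟩ : ∃ s : ℝ⟦X⟧, s = 1 - 2 * f0 := ⟨_, rfl⟩
  have hcs : constantCoeff s = 1 := by rw [hs]; simp [hc]
  obtain ⟨u, hu⟩ : ∃ u : ℝ⟦X⟧, u = s⁻¹ := ⟨_, rfl⟩
  have hsu : s * u = 1 := by
    rw [hu]; exact PowerSeries.mul_inv_cancel s (by rw [hcs]; exact one_ne_zero)
  have hss : s * s = 1 - 4 * X := by
    rw [hs]; linear_combination (-4) * h0
  have hcu : constantCoeff u = 1 := by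
    have := congrArg constantCoeff hsu
    rw [map_mul, hcs] at this; simpa using this
  have hθs : 2 * θ s = s - u := by
    have h := congrArg θ hss
    rw [Derivation.leibniz, map_sub, θ_ofNat_mul, θ_X, θ_one] at h
    simp only [smul_eq_mul] at h
    -- s θs + s θs = -4X = s² - 1
    linear_combination u * h - u * hss - (2 * θ s - s) * hsu
  have hθu : 2 * θ u = u ^ 3 - u := by
    have h := congrArg θ hsu
    rw [Derivation.leibniz, θ_one] at h
    simp only [smul_eq_mul] at h
    linear_combination 2 * u * h - u ^ 2 * hθs - (2 * θ u + u) * hsu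
  have hp := θ_pow u hθu
  have p2 : 2 * θ (u ^ 2) = 2 * (u ^ 4 - u ^ 2) := mod_cast hp 2
  have p3 : 2 * θ (u ^ 3) = 3 * (u ^ 5 - u ^ 3) := mod_cast hp 3
  have p4 : 2 * θ (u ^ 4) = 4 * (u ^ 6 - u ^ 4) := mod_cast hp 4
  have p5 : 2 * θ (u ^ 5) = 5 * (u ^ 7 - u ^ 5) := mod_cast hp 5
  have hf0 : 2 * f0 = 1 - s := by rw [hs]; ring
  have hg0 : 4 * (f0 * f0) = 1 - 2 * s + s ^ 2 := by
    linear_combination (2 * f0 + 1 - s) * hf0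
  have hg0' : 4 * (f0 * f0) = 2 - 2 * s - 4 * X := by
    linear_combination hg0 + hss
  have e1 : 4 * E (f0 * f0) = s + u - 2 := by
    have h := E_nat 4 _ _ hg0'
    simp only [map_add, map_sub, θ_mul2, θ_mul3, θ_mul4, θ_mul5, θ_mul10, θ_mul13, θ_mul20, θ_mul23, θ_cst2, θ_cst3, θ_cst4, θ_cst6, θ_cst9,
      θ_X, θ_one] at h
    push_cast at h
    linear_combination h - hθs
  have hf1 : 2 * f1 = 1 - 2 * u + u ^ 2 := by
    linear_combination 2 * u * h1 + u * e1 + 2 * u * f1 * hf0 + (1 - 2 * f1) * hsu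
  have hg1 : 2 * (2 * (f0 * f1)) = 3 - 3 * u + u ^ 2 - s := by
    linear_combination 2 * f1 * hf0 + (1 - s) * hf1 + (2 - u) * hsu
  have e2 : 8 * E (E (f0 * f0)) = 4 - s - 4 * u + u ^ 3 := by
    have h := E_nat 4 _ _ e1
    simp only [map_add, map_sub, θ_mul2, θ_mul3, θ_mul4, θ_mul5, θ_mul10, θ_mul13, θ_mul20, θ_mul23, θ_cst2, θ_cst3, θ_cst4, θ_cst6, θ_cst9,
      θ_X, θ_one] at h
    push_cast at h
    linear_combination 2 * h + hθs + hθu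
  have e3 : 16 * E (E (E (f0 * f0))) = -8 + s + 13 * u - 9 * u ^ 3 + 3 * u ^ 5 := by
    have h := E_nat 8 _ _ e2
    simp only [map_add, map_sub, θ_mul2, θ_mul3, θ_mul4, θ_mul5, θ_mul10, θ_mul13, θ_mul20, θ_mul23, θ_cst2, θ_cst3, θ_cst4, θ_cst6, θ_cst9,
      θ_X, θ_one] at h
    push_cast at h
    linear_combination 2 * h - hθs - 4 * hθu + p3
  have k1 : 4 * E (2 * (f0 * f1)) = -6 + s + 10 * u - 4 * u ^ 2 - 3 * u ^ 3 + 2 * u ^ 4 := by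
    have h := E_nat 2 _ _ hg1
    simp only [map_add, map_sub, θ_mul2, θ_mul3, θ_mul4, θ_mul5, θ_mul10, θ_mul13, θ_mul20, θ_mul23, θ_cst2, θ_cst3, θ_cst4, θ_cst6, θ_cst9,
      θ_X, θ_one] at h
    push_cast at h
    linear_combination 2 * h - hθs - 3 * hθu + p2
  have hf2 : 2 * f2 = 1 - 7 * u + 12 * u ^ 2 - 2 * u ^ 3 - 9 * u ^ 4 + 5 * u ^ 5 := by
    linear_combination 2 * u * h2 + u * e2 + 2 * u * k1 + 2 * u * f2 * hf0
      + u * (2 * f1 + (1 - 2 * u + u ^ 2)) * hf1 + (1 - 2 * f2) * hsu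
  have hg2 : 2 * (2 * (f0 * f2) + 2 * (f1 * f1)) =
      9 - 23 * u + 20 * u ^ 2 + 3 * u ^ 3 - 13 * u ^ 4 + 5 * u ^ 5 - s := by
    linear_combination 2 * f2 * hf0 + (1 - s) * hf2 + (2 * f1 + (1 - 2 * u + u ^ 2)) * hf1
      + (7 - 12 * u + 2 * u ^ 2 + 9 * u ^ 3 - 5 * u ^ 4) * hsu
  have k2 : 8 * E (E (2 * (f0 * f1))) = 12 - s - 31 * u + 16 * u ^ 2 + 25 * u ^ 3
      - 20 * u ^ 4 - 9 * u ^ 5 + 8 * u ^ 6 := by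
    have h := E_nat 4 _ _ k1
    simp only [map_add, map_sub, map_neg, θ_mul2, θ_mul3, θ_mul4, θ_mul5, θ_mul10, θ_mul13, θ_mul20, θ_mul23, θ_cst2, θ_cst3, θ_cst4, θ_cst6, θ_cst9,
      θ_X, θ_one] at h
    push_cast at h
    linear_combination 2 * h + hθs + 10 * hθu - 4 * p2 - 3 * p3 + 2 * p4
  have l2 : 4 * E (2 * (f0 * f2) + 2 * (f1 * f1)) = -18 + s + 70 * u - 80 * u ^ 2 - 38 * u ^ 3
      + 118 * u ^ 4 - 26 * u ^ 5 - 52 * u ^ 6 + 25 * u ^ 7 := by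
    have h := E_nat 2 _ _ hg2
    rw [map_add]
    simp only [map_add, map_sub, map_neg, θ_mul2, θ_mul3, θ_mul4, θ_mul5, θ_mul10, θ_mul13, θ_mul20, θ_mul23, θ_cst2, θ_cst3, θ_cst4, θ_cst6, θ_cst9,
      θ_X, θ_one] at h
    push_cast at h
    linear_combination 2 * h - hθs - 23 * hθu + 20 * p2 + 3 * p3 - 13 * p4 + 5 * p5
  have hf3 : 2 * f3 = 1 - 23 * u + 103 * u ^ 2 - 111 * u ^ 3 - 147 * u ^ 4 + 315 * u ^ 5
        - 39 * u ^ 6 - 189 * u ^ 7 + 90 * u ^ 8 := by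
    linear_combination 2 * u * h3 + u * e3 + 3 * u * k2 + 3 * u * l2 + 2 * u * f3 * hf0
      + 3 * u * (2 * f2) * hf1 + 3 * u * (1 - 2 * u + u ^ 2) * hf2 + (1 - 2 * f3) * hsu
  exact ⟨s, u, hsu, hss, hcu, hθs, hθu, hf0, hf1, hf2, hf3⟩

/-! ### Coefficients -/

lemma coeff_nat_mul (c : ℕ) (g : ℝ⟦X⟧) (n : ℕ) :
    coeff n ((c : ℝ⟦X⟧) * g) = c * coeff n g := by
  rw [← nsmul_eq_mul, ← nsmul_eq_mul, map_nsmul]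

lemma coeff_ofNat_mul (c : ℕ) (d : ℝ⟦X⟧) (h : (c : ℝ⟦X⟧) = d) (g : ℝ⟦X⟧) (n : ℕ) :
    coeff n (d * g) = c * coeff n g := by
  rw [← h, coeff_nat_mul]

lemma exists_b (T : ℕ → Finset PTree)
    (hT : ∀ n : ℕ, ∀ t : PTree, t ∈ T n ↔ t.size = 2 * n + 1 ∧ t.validDeg {2}) :
    ∃ b : ℕ → ℝ, b 0 = 1 ∧ (∀ N : ℕ, ((N : ℝ) + 1) * b (N + 1) = (4 * N + 2) * b N) ∧
      ∀ n : ℕ, ∀ N : ℝ, N = (n : ℝ) + 1 →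
        2 * (2 * N - 1) * M T 0 n = b (n + 1) ∧
        2 * M T 1 n = 4 ^ (n + 1) - 2 * b (n + 1) ∧
        2 * M T 2 n = 4 ^ (n + 1) * (12 - 9 * (N + 1)) + b (n + 1) *
          (-7 - 2 * (2 * N + 1) + 5 * ((2 * N / 3 + 1) * (2 * N + 1))) ∧
        2 * M T 3 n = 4 ^ (n + 1) * (103 - 147 * (N + 1) - 39 * ((N / 2 + 1) * (N + 1))
            + 90 * ((N / 3 + 1) * (N / 2 + 1) * (N + 1)))
          + b (n + 1) * (-23 - 111 * (2 * N + 1) + 315 * ((2 * N / 3 + 1) * (2 * N + 1))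
            - 189 * ((2 * N / 5 + 1) * (2 * N / 3 + 1) * (2 * N + 1))) := by
  obtain ⟨s, u, hsu, hss, hcu, hθs, hθu, hf0, hf1, hf2, hf3⟩ :=
    algebra_core (f T 0) (f T 1) (f T 2) (f T 3) (eq0 T hT) (eq1 T hT) (eq2 T hT) (eq3 T hT)
      (by rw [← PowerSeries.coeff_zero_eq_constantCoeff_apply]; exact coeff_zero_f T 0)
  have c2 := coeff_ofNat_mul 2 2 Nat.cast_ofNat
  have c4 := coeff_ofNat_mul 4 4 Nat.cast_ofNat
  have step (m N : ℕ) : (m : ℝ) * coeff N (u ^ (m + 2)) = (2 * N + m) * coeff N (u ^ m) := by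
    have h := congrArg (coeff N) (θ_pow u hθu m)
    rw [c2, coeff_nat_mul, map_sub, coeff_θ] at h
    push_cast at h
    linarith
  have a2 (N : ℕ) : coeff N (u ^ 2) = (4 : ℝ) ^ N := by
    have e : u ^ 2 = 1 + 4 * (X * u ^ 2) := by
      linear_combination (1 + s * u) * hsu - u ^ 2 * hss
    induction N with
    | zero =>
      rw [PowerSeries.coeff_zero_eq_constantCoeff_apply, map_pow, hcu]; simp
    | succ N ih =>
      rw [e, map_add, c4, PowerSeries.coeff_succ_X_mul, ih, PowerSeries.coeff_one]
      simp [pow_succ, mul_comm]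
  have a3 (N : ℕ) : coeff N (u ^ 3) = (2 * N + 1) * coeff N u := by
    have := step 1 N
    norm_num at this
    exact this
  have a4 (N : ℕ) : coeff N (u ^ 4) = ((N : ℝ) + 1) * (4 : ℝ) ^ N := by
    have := step 2 N
    norm_num [a2] at this
    linarith
  have a5 (N : ℕ) : coeff N (u ^ 5) = (2 * N / 3 + 1) * (2 * N + 1) * coeff N u := by
    have := step 3 N
    norm_num [a3] at this
    linarith
  have a6 (N : ℕ) : coeff N (u ^ 6) = ((N : ℝ) / 2 + 1) * ((N : ℝ) + 1) * (4 : ℝ) ^ N := by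
    have := step 4 N
    norm_num [a4] at this
    linarith
  have a7 (N : ℕ) : coeff N (u ^ 7) =
      (2 * N / 5 + 1) * (2 * N / 3 + 1) * (2 * N + 1) * coeff N u := by
    have := step 5 N
    norm_num [a5] at this
    linarith
  have a8 (N : ℕ) : coeff N (u ^ 8) =
      ((N : ℝ) / 3 + 1) * ((N : ℝ) / 2 + 1) * ((N : ℝ) + 1) * (4 : ℝ) ^ N := by
    have := step 6 N
    norm_num [a6] at this
    linarith
  refine ⟨fun N => coeff N u, ?_, ?_, ?_⟩
  · simpa using hcu
  · intro N
    have e : u = u ^ 3 - 4 * (X * u ^ 3) := by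
      linear_combination (-u * (1 + s * u)) * hsu + u ^ 3 * hss
    have h := congrArg (coeff (N + 1)) e
    rw [map_sub, c4, PowerSeries.coeff_succ_X_mul, a3, a3] at h
    push_cast at h ⊢
    linarith
  · rintro n N rfl
    have one0 : coeff (n + 1) (1 : ℝ⟦X⟧) = 0 := by
      rw [PowerSeries.coeff_one]; simp
    have hcst (c : ℕ) (d : ℝ⟦X⟧) (h : (c : ℝ⟦X⟧) = d) (g : ℝ⟦X⟧) :=
      coeff_ofNat_mul c d h g (n + 1)
    refine ⟨?_, ?_, ?_, ?_⟩
    · have h := congrArg (coeff (n + 1)) hf0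
      have h' := congrArg (coeff (n + 1)) hθs
      rw [c2, map_sub, one0, coeff_f] at h
      rw [c2, map_sub, coeff_θ] at h'
      push_cast at h h'
      have h2 : coeff (n + 1) s = -2 * M T 0 n := by linarith
      rw [h2] at h'
      linarith
    · have h := congrArg (coeff (n + 1)) hf1
      simp only [map_add, map_sub, one0, c2, coeff_f, a2] at h
      push_cast at h ⊢
      linarith
    · have h := congrArg (coeff (n + 1)) hf2
      simp only [map_add, map_sub, one0, c2, hcst 7 7 Nat.cast_ofNat, hcst 12 12 Nat.cast_ofNat,
        hcst 9 9 Nat.cast_ofNat, hcst 5 5 Nat.cast_ofNat, coeff_f, a2, a3, a4, a5] at h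
      push_cast at h ⊢
      linarith
    · have h := congrArg (coeff (n + 1)) hf3
      simp only [map_add, map_sub, one0, c2, hcst 23 23 Nat.cast_ofNat,
        hcst 103 103 Nat.cast_ofNat, hcst 111 111 Nat.cast_ofNat, hcst 147 147 Nat.cast_ofNat,
        hcst 315 315 Nat.cast_ofNat, hcst 39 39 Nat.cast_ofNat, hcst 189 189 Nat.cast_ofNat,
        hcst 90 90 Nat.cast_ofNat, coeff_f, a2, a3, a4, a5, a6, a7, a8] at h
      push_cast at h ⊢
      linarith

/-! ### Asymptotics -/

open Filter Real

lemma b_pos (b : ℕ → ℝ) (h0 : b 0 = 1)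
    (h : ∀ N : ℕ, ((N : ℝ) + 1) * b (N + 1) = (4 * N + 2) * b N) (N : ℕ) : 0 < b N := by
  induction N with
  | zero => rw [h0]; exact one_pos
  | succ N ih =>
    have h1 : 0 < ((N : ℝ) + 1) * b (N + 1) := by rw [h]; positivity
    exact pos_of_mul_pos_right h1 (by positivity)

lemma wallis_b (b : ℕ → ℝ) (h0 : b 0 = 1)
    (h : ∀ N : ℕ, ((N : ℝ) + 1) * b (N + 1) = (4 * N + 2) * b N) (N : ℕ) :
    ((4 : ℝ) ^ N) ^ 2 = Wallis.W N * (2 * N + 1) * b N ^ 2 := by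
  induction N with
  | zero => simp [h0, Wallis.W]
  | succ N ih =>
    have hb : b (N + 1) = (4 * N + 2) * b N / ((N : ℝ) + 1) := by
      rw [eq_div_iff (by positivity), ← h]; ring
    rw [Wallis.W_succ, hb, pow_succ (4 : ℝ) N, mul_pow, ih]
    have h1 : (2 * (N : ℝ) + 1) ≠ 0 := by positivity
    have h2 : (2 * (N : ℝ) + 3) ≠ 0 := by positivity
    have h3 : ((N : ℝ) + 1) ≠ 0 := by positivity
    push_cast
    field_simp
    ring

lemma tendsto_r (b : ℕ → ℝ) (h0 : b 0 = 1)
    (h : ∀ N : ℕ, ((N : ℝ) + 1) * b (N + 1) = (4 * N + 2) * b N) :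
    Tendsto (fun n : ℕ => (4 : ℝ) ^ (n + 1) / (b (n + 1) * √((n : ℝ) + 1))) atTop
      (nhds (√π)) := by
  have hx : Tendsto (fun n : ℕ => 1 / ((n : ℝ) + 1)) atTop (nhds 0) :=
    tendsto_one_div_add_atTop_nhds_zero_nat
  have hW : Tendsto (fun n : ℕ => Wallis.W (n + 1)) atTop (nhds (π / 2)) :=
    (tendsto_add_atTop_iff_nat 1).2 Wallis.tendsto_W_nhds_pi_div_two
  have key : Tendsto (fun n : ℕ => √(Wallis.W (n + 1) * (2 + 1 / ((n : ℝ) + 1)))) atTop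
      (nhds (√(π / 2 * (2 + 0)))) :=
    (hW.mul (hx.const_add 2)).sqrt
  rw [show π / 2 * (2 + 0) = π by ring] at key
  refine key.congr fun n => ?_
  have hb := b_pos b h0 h (n + 1)
  have hn : (0 : ℝ) < (n : ℝ) + 1 := by positivity
  have e : Wallis.W (n + 1) * (2 + 1 / ((n : ℝ) + 1)) =
      ((4 : ℝ) ^ (n + 1) / (b (n + 1) * √((n : ℝ) + 1))) ^ 2 := by
    rw [div_pow, mul_pow, Real.sq_sqrt hn.le, wallis_b b h0 h]
    push_cast
    field_simp
  rw [e, Real.sqrt_sq (by positivity)]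

lemma tendsto_x : Tendsto (fun n : ℕ => 1 / √((n : ℝ) + 1)) atTop (nhds 0) := by
  have hx : Tendsto (fun n : ℕ => 1 / ((n : ℝ) + 1)) atTop (nhds 0) :=
    tendsto_one_div_add_atTop_nhds_zero_nat
  have := hx.sqrt
  simpa using this

lemma lim_poly (r x : ℕ → ℝ) (R : ℝ) (hr : Tendsto r atTop (nhds R))
    (hx : Tendsto x atTop (nhds 0)) (F : ℝ × ℝ → ℝ) (hF : Continuous F) :
    Tendsto (fun n => F (r n, x n)) atTop (nhds (F (R, 0))) :=
  (hF.tendsto (R, 0)).comp (hr.prodMk_nhds hx)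

/-- Normalised first moment. -/
noncomputable def P1 (p : ℝ × ℝ) : ℝ := (2 - p.2 ^ 2) * (p.1 - 2 * p.2)

/-- Normalised second moment. -/
noncomputable def P2 (p : ℝ × ℝ) : ℝ := (2 - p.2 ^ 2) *
  (-7 * p.2 ^ 4 + 12 * p.1 * p.2 ^ 3 - 2 * (2 + p.2 ^ 2) * p.2 ^ 2
    - 9 * p.1 * p.2 * (1 + p.2 ^ 2) + 5 * (2 / 3 + p.2 ^ 2) * (2 + p.2 ^ 2))

/-- Normalised third moment. -/
noncomputable def P3 (p : ℝ × ℝ) : ℝ := (2 - p.2 ^ 2) *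
  (-23 * p.2 ^ 7 + 103 * p.1 * p.2 ^ 6 - 111 * (2 + p.2 ^ 2) * p.2 ^ 5
    - 147 * p.1 * p.2 ^ 4 * (1 + p.2 ^ 2)
    + 315 * p.2 ^ 3 * (2 / 3 + p.2 ^ 2) * (2 + p.2 ^ 2)
    - 39 * p.1 * p.2 ^ 2 * (1 / 2 + p.2 ^ 2) * (1 + p.2 ^ 2)
    - 189 * p.2 * (2 / 5 + p.2 ^ 2) * (2 / 3 + p.2 ^ 2) * (2 + p.2 ^ 2)
    + 90 * p.1 * (1 / 3 + p.2 ^ 2) * (1 / 2 + p.2 ^ 2) * (1 + p.2 ^ 2))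

lemma normalised (T : ℕ → Finset PTree)
    (hT : ∀ n : ℕ, ∀ t : PTree, t ∈ T n ↔ t.size = 2 * n + 1 ∧ t.validDeg {2}) :
    ∃ r : ℕ → ℝ, Tendsto r atTop (nhds (√π)) ∧ ∀ n : ℕ, ∀ y x : ℝ,
      y = √((n : ℝ) + 1) → x = 1 / √((n : ℝ) + 1) → 0 < M T 0 n ∧
      M T 1 n / M T 0 n = y ^ 3 * P1 (r n, x) ∧
      M T 2 n / M T 0 n = y ^ 6 * P2 (r n, x) ∧
      M T 3 n / M T 0 n = y ^ 9 * P3 (r n, x) := by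
  obtain ⟨b, h0, hb, hM⟩ := exists_b T hT
  refine ⟨_, tendsto_r b h0 hb, ?_⟩
  intro n y x hy hx
  obtain ⟨m0, m1, m2, m3⟩ := hM n _ rfl
  have hbp := b_pos b h0 hb (n + 1)
  have hn : (0 : ℝ) < (n : ℝ) + 1 := by positivity
  have hyp : 0 < y := by rw [hy]; positivity
  have hN : (n : ℝ) + 1 = y ^ 2 := by rw [hy, Real.sq_sqrt hn.le]
  have hy1 : 1 ≤ y ^ 2 := by rw [← hN]; linarith [(Nat.cast_nonneg n : (0 : ℝ) ≤ n)]
  rw [← hy] at hx ⊢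
  rw [hN] at m0 m2 m3
  generalize b (n + 1) = B at *
  generalize (4 : ℝ) ^ (n + 1) = Q at *
  have hpos : 0 < M T 0 n := by
    have : 0 < 2 * (2 * y ^ 2 - 1) * M T 0 n := by rw [m0]; exact hbp
    exact pos_of_mul_pos_right this (by linarith)
  have hB : B ≠ 0 := hbp.ne'
  have hy0 : y ≠ 0 := hyp.ne'
  have hQ : ∃ ρ, ρ = Q / (B * y) := ⟨_, rfl⟩
  obtain ⟨ρ, hρ⟩ := hQ
  have hQ' : Q = ρ * B * y := by rw [hρ]; field_simp
  have hxy : x * y = 1 := by rw [hx]; field_simp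
  rw [← hρ]
  have hm0 : B = 2 * (2 * y ^ 2 - 1) * M T 0 n := m0.symm
  have hx' : x = y⁻¹ := by rw [hx]; simp
  refine ⟨hpos, ?_, ?_, ?_⟩
  · rw [div_eq_iff hpos.ne']
    rw [hQ', hm0] at m1
    have : M T 1 n = (2 * y ^ 2 - 1) * (ρ * y - 2) * M T 0 n := by linarith
    rw [this, P1, hx']
    congr 1
    simp only
    field_simp
  · rw [div_eq_iff hpos.ne']
    rw [hQ', hm0] at m2
    have : M T 2 n = ((2 * y ^ 2 - 1) * (ρ * y * (12 - 9 * (y ^ 2 + 1)) +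
       (-7 - 2 * (2 * y ^ 2 + 1) + 5 * ((2 * y ^ 2 / 3 + 1) * (2 * y ^ 2 + 1))))) * M T 0 n := by
      linarith
    rw [this, P2, hx']
    congr 1
    simp only
    field_simp
    ring
  · rw [div_eq_iff hpos.ne']
    rw [hQ', hm0] at m3
    have : M T 3 n = ((2 * y ^ 2 - 1) * (ρ * y * (103 - 147 * (y ^ 2 + 1)
            - 39 * ((y ^ 2 / 2 + 1) * (y ^ 2 + 1))
            + 90 * ((y ^ 2 / 3 + 1) * (y ^ 2 / 2 + 1) * (y ^ 2 + 1)))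
          + (-23 - 111 * (2 * y ^ 2 + 1) + 315 * ((2 * y ^ 2 / 3 + 1) * (2 * y ^ 2 + 1))
            - 189 * ((2 * y ^ 2 / 5 + 1) * (2 * y ^ 2 / 3 + 1) * (2 * y ^ 2 + 1))))) * M T 0 n := by
      linarith
    rw [this, P3, hx']
    congr 1
    simp only
    field_simp
    ring

lemma final_const :
    (30 * √π - 3 * (2 * √π) * (40 / 3) + 2 * (2 * √π) ^ 3) /
      (40 / 3 - (2 * √π) ^ 2) ^ ((3 : ℝ) / 2) =
    (6 * π - 75 / 4) * √3 * √(π / (10 - 3 * π)) / (10 - 3 * π) := by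
  have hπ : 0 < 10 - 3 * π := by linarith [Real.pi_lt_d2]
  have hsq : √π ^ 2 = π := Real.sq_sqrt Real.pi_pos.le
  obtain ⟨d, hd⟩ : ∃ d, d = √(10 - 3 * π) := ⟨_, rfl⟩
  have hdp : 0 < d := by rw [hd]; positivity
  have hd2 : 10 - 3 * π = d ^ 2 := by rw [hd, Real.sq_sqrt hπ.le]
  have h3 : √(3 : ℝ) ^ 2 = 3 := Real.sq_sqrt (by norm_num)
  have h3p : 0 < √(3 : ℝ) := by positivity
  have hL : 40 / 3 - (2 * √π) ^ 2 = (2 * d / √3) ^ 2 := by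
    rw [div_pow, mul_pow, mul_pow, h3, hsq, ← hd2]; ring
  have hpow : ((2 * d / √3) ^ 2) ^ ((3 : ℝ) / 2) = (2 * d / √3) ^ 3 := by
    have hp : 0 ≤ 2 * d / √3 := by positivity
    rw [← Real.rpow_natCast, ← Real.rpow_mul hp, ← Real.rpow_natCast]
    norm_num
  rw [hL, hpow, Real.sqrt_div Real.pi_pos.le, ← hd, hd2]
  have h33 : √(3 : ℝ) ^ 3 = 3 * √3 := by rw [pow_succ, h3]
  have hnum : 30 * √π - 3 * (2 * √π) * (40 / 3) + 2 * (2 * √π) ^ 3 =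
      (8 / 3) * (6 * π - 75 / 4) * √π := by
    linear_combination 16 * √π * hsq
  rw [hnum, div_pow, h33]
  field_simp
  ring

lemma cm2 (S : Finset PTree) (h : PTree → ℝ) (hS : (S.card : ℝ) ≠ 0) (a c : ℝ)
    (ha : (∑ t ∈ S, h t) / S.card = a) (hc : (∑ t ∈ S, h t ^ 2) / S.card = c) :
    (∑ t ∈ S, (h t - a) ^ 2) / S.card = c - a ^ 2 := by
  have e : ∑ t ∈ S, (h t - a) ^ 2 =
      ∑ t ∈ S, h t ^ 2 - 2 * a * ∑ t ∈ S, h t + S.card * a ^ 2 := by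
    rw [Finset.mul_sum, ← nsmul_eq_mul, ← Finset.sum_const, ← Finset.sum_sub_distrib,
      ← Finset.sum_add_distrib]
    exact Finset.sum_congr rfl fun t _ => by ring
  rw [div_eq_iff hS] at ha hc ⊢
  rw [e, ha, hc]; ring

lemma cm3 (S : Finset PTree) (h : PTree → ℝ) (hS : (S.card : ℝ) ≠ 0) (a c d : ℝ)
    (ha : (∑ t ∈ S, h t) / S.card = a) (hc : (∑ t ∈ S, h t ^ 2) / S.card = c)
    (hd : (∑ t ∈ S, h t ^ 3) / S.card = d) :
    (∑ t ∈ S, (h t - a) ^ 3) / S.card = d - 3 * a * c + 2 * a ^ 3 := by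
  have e : ∑ t ∈ S, (h t - a) ^ 3 =
      ∑ t ∈ S, h t ^ 3 - 3 * a * ∑ t ∈ S, h t ^ 2 + 3 * a ^ 2 * ∑ t ∈ S, h t
        + S.card * (-a ^ 3) := by
    rw [Finset.mul_sum, Finset.mul_sum, ← nsmul_eq_mul, ← Finset.sum_const,
      ← Finset.sum_sub_distrib, ← Finset.sum_add_distrib, ← Finset.sum_add_distrib]
    exact Finset.sum_congr rfl fun t _ => by ring
  rw [div_eq_iff hS] at ha hc hd ⊢
  rw [e, ha, hc, hd]; ring

end TH

open Filter Real

/-- Let `H_n` be the total height (sum over all vertices of the distance to the root) on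
complete binary trees with `2n+1` vertices, under the uniform distribution; with mean
`μ n`, central moments `m i n`, and scaled moments `α i n = m i n / (m 2 n)^(i/2)`,
the `3`-th scaled moment converges as `n → ∞` to the stated constant. -/
theorem totalheight_stmt7 (T : ℕ → Finset PTree)
    (hT : ∀ n : ℕ, ∀ t : PTree, t ∈ T n ↔ t.size = 2 * n + 1 ∧ t.validDeg {2})
    (μ : ℕ → ℝ)
    (hμ : ∀ n : ℕ, μ n = (∑ t ∈ T n, (t.totalHeight : ℝ)) / ((T n).card : ℝ))
    (m : ℕ → ℕ → ℝ)
    (hm : ∀ i n : ℕ, m i n =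
      (∑ t ∈ T n, ((t.totalHeight : ℝ) - μ n) ^ i) / ((T n).card : ℝ))
    (α : ℕ → ℕ → ℝ)
    (hα : ∀ i n : ℕ, α i n = m i n / (m 2 n) ^ ((i : ℝ) / 2)) :
    Tendsto (fun n : ℕ => α 3 n) atTop
      (nhds ((6 * π - 75 / 4) * Real.sqrt 3 * Real.sqrt (π / (10 - 3 * π)) / (10 - 3 * π))) := by
  obtain ⟨r, hr, hn⟩ := TH.normalised T hT
  have hx := TH.tendsto_x
  have c1 : Continuous TH.P1 := by unfold TH.P1; fun_prop
  have c2 : Continuous TH.P2 := by unfold TH.P2; fun_prop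
  have c3 : Continuous TH.P3 := by unfold TH.P3; fun_prop
  have l1 := TH.lim_poly r _ _ hr hx TH.P1 c1
  have l2 := TH.lim_poly r _ _ hr hx TH.P2 c2
  have l3 := TH.lim_poly r _ _ hr hx TH.P3 c3
  have e1 : TH.P1 (√π, 0) = 2 * √π := by unfold TH.P1; norm_num
  have e2 : TH.P2 (√π, 0) = 40 / 3 := by unfold TH.P2; norm_num
  have e3 : TH.P3 (√π, 0) = 30 * √π := by unfold TH.P3; norm_num; ring
  rw [e1] at l1
  rw [e2] at l2
  rw [e3] at l3
  have hpos : 0 < 40 / 3 - (2 * √π) ^ 2 := by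
    rw [mul_pow, Real.sq_sqrt Real.pi_pos.le]
    linarith [Real.pi_lt_d2]
  have lnum := (l3.sub ((l1.const_mul 3).mul l2)).add ((l1.pow 3).const_mul 2)
  have lden := (l2.sub (l1.pow 2)).rpow_const (p := (3 : ℝ) / 2) (Or.inl hpos.ne')
  have lim := lnum.div lden (Real.rpow_pos_of_pos hpos _).ne'
  rw [TH.final_const] at lim
  refine lim.congr fun n => ?_
  rw [Pi.div_apply]
  obtain ⟨h0, h1, h2, h3⟩ := hn n _ _ rfl rfl
  have hcard : TH.M T 0 n = ((T n).card : ℝ) := by simp [TH.M]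
  have hyp : 0 < √((n : ℝ) + 1) := by positivity
  rw [hcard] at h0 h1 h2 h3
  simp only [TH.M, pow_one] at h1 h2 h3
  have hμn := (hμ n).trans h1
  have k2 := TH.cm2 (T n) (fun t => (t.totalHeight : ℝ)) h0.ne' _ _ h1 h2
  have k3 := TH.cm3 (T n) (fun t => (t.totalHeight : ℝ)) h0.ne' _ _ _ h1 h2 h3
  have hm2 := hm 2 n
  have hm3 := hm 3 n
  have hnn : 0 ≤ m 2 n := by
    rw [hm2]
    exact div_nonneg (Finset.sum_nonneg fun t _ => sq_nonneg _) h0.le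
  rw [hμn, k2] at hm2
  rw [hμn, k3] at hm3
  generalize √((n : ℝ) + 1) = y at *
  generalize TH.P1 (r n, 1 / y) = p1 at *
  generalize TH.P2 (r n, 1 / y) = p2 at *
  generalize TH.P3 (r n, 1 / y) = p3 at *
  have hm2' : m 2 n = y ^ 6 * (p2 - p1 ^ 2) := by rw [hm2]; ring
  have hm3' : m 3 n = y ^ 9 * (p3 - 3 * p1 * p2 + 2 * p1 ^ 3) := by rw [hm3]; ring
  have hz : 0 ≤ p2 - p1 ^ 2 := by
    rw [hm2'] at hnn
    exact nonneg_of_mul_nonneg_right hnn (by positivity)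
  have hy9 : (y ^ 6) ^ ((3 : ℝ) / 2) = y ^ 9 := by
    rw [← Real.rpow_natCast, ← Real.rpow_mul hyp.le, ← Real.rpow_natCast]
    norm_num
  rw [hα, hm2', hm3', Nat.cast_ofNat, Real.mul_rpow (by positivity) hz, hy9,
    mul_div_mul_left _ _ (by positivity)]
end

section
/- For n ≥ 1, let H_n be the random variable 'total height' (sum over all vertices of the distance to the root) on the set of complete binary trees with 2n+1 vertices, equipped with the uniform distribution. Let μ(n) = E[H_n], m_i(n) = E[(H_n − μ(n))^i], and α_i(n) = m_i(n)/m_2(n)^{i/2}. Then the limit of the kurtosis exists and lim_{n→∞} α_4(n) = (−189π² + 315π + 884) / (7·(10 − 3π)²) ≈ 3.560394897132889…. -/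
open Filter Real

namespace TH

open BinaryTree Finset PowerSeries

/-- embedding of Mathlib binary trees in plane trees -/
def emb : BinaryTree Unit → PTree
  | .nil => .node []
  | .node _ l r => .node [emb l, emb r]

theorem emb_size (t : BinaryTree Unit) : (emb t).size = 2 * t.numNodes + 1 := by
  induction t with
  | nil => simp [emb, PTree.size, numNodes]
  | node _ l r hl hr => simp [emb, PTree.size, numNodes, hl, hr]; ring

theorem emb_valid (t : BinaryTree Unit) : (emb t).validDeg {2} := by
  induction t with
  | nil => simp [emb, PTree.validDeg]
  | node _ l r hl hr => simp [emb, PTree.validDeg, hl, hr]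

theorem emb_inj : Function.Injective emb := by
  intro a
  induction a with
  | nil => intro b h; cases b with
    | nil => rfl
    | node _ l r => simp [emb] at h
  | node _ l r hl hr => intro b h; cases b with
    | nil => simp [emb] at h
    | node _ l' r' =>
      simp only [emb, PTree.node.injEq, List.cons.injEq, and_true] at h
      rw [hl h.1, hr h.2]

theorem emb_surj (t : PTree) (h : t.validDeg {2}) : ∃ b, emb b = t := by
  match t, h with
  | .node [], _ => exact ⟨.nil, rfl⟩
  | .node [x], h => simp [PTree.validDeg] at h
  | .node [x, y], h =>
    simp only [PTree.validDeg, List.mem_cons, List.not_mem_nil, or_false, forall_eq_or_imp,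
      forall_eq] at h
    obtain ⟨a, ha⟩ := emb_surj x h.2.1
    obtain ⟨b, hb⟩ := emb_surj y h.2.2
    exact ⟨.node () a b, by simp [emb, ha, hb]⟩
  | .node (x :: y :: z :: l), h => simp [PTree.validDeg] at h

theorem T_eq (T : ℕ → Finset PTree)
    (hT : ∀ n : ℕ, ∀ t : PTree, t ∈ T n ↔ t.size = 2 * n + 1 ∧ t.validDeg {2}) (n : ℕ) :
    T n = (treesOfNumNodesEq n).map ⟨emb, emb_inj⟩ := by
  ext t
  simp only [hT, Finset.mem_map, mem_treesOfNumNodesEq, Function.Embedding.coeFn_mk]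
  constructor
  · rintro ⟨h1, h2⟩
    obtain ⟨b, rfl⟩ := emb_surj t h2
    rw [emb_size] at h1
    exact ⟨b, by omega, rfl⟩
  · rintro ⟨b, rfl, rfl⟩
    exact ⟨emb_size b, emb_valid b⟩

/-- shifted total height, without the contribution of the root -/
noncomputable def Q : BinaryTree Unit → ℝ
  | .nil => 0
  | .node _ l r => (Q l + 2 * (l.numNodes + 1)) + (Q r + 2 * (r.numNodes + 1))

/-- shifted total height -/
noncomputable def Z (t : BinaryTree Unit) : ℝ := Q t + 2 * (t.numNodes + 1)

theorem height_emb (t : BinaryTree Unit) :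
    ((emb t).totalHeight : ℝ) = Z t - (4 * t.numNodes + 2) := by
  induction t with
  | nil => simp [emb, PTree.totalHeight, Z, Q, numNodes]
  | node _ l r hl hr =>
    simp only [Z] at hl hr
    simp only [emb, PTree.totalHeight, Z, Q, numNodes]
    simp [hl, hr, emb_size]
    ring

/-- twice the power sums of `Q` -/
noncomputable def w (k n : ℕ) : ℝ := 2 * ∑ t ∈ treesOfNumNodesEq n, Q t ^ k

/-- twice the power sums of `Z` -/
noncomputable def v (k n : ℕ) : ℝ := 2 * ∑ t ∈ treesOfNumNodesEq n, Z t ^ k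

/-- generating function of `w` -/
noncomputable def W (k : ℕ) : ℝ⟦X⟧ := X * PowerSeries.mk (w k)

/-- generating function of `v` -/
noncomputable def V (k : ℕ) : ℝ⟦X⟧ := X * PowerSeries.mk (v k)

theorem sum_trees_succ (n : ℕ) (F : BinaryTree Unit → ℝ) :
    ∑ t ∈ treesOfNumNodesEq (n + 1), F t = ∑ ij ∈ antidiagonal n,
      ∑ l ∈ treesOfNumNodesEq ij.1, ∑ r ∈ treesOfNumNodesEq ij.2, F (.node () l r) := by
  rw [treesOfNumNodesEq_succ, sum_biUnion]
  · apply sum_congr rfl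
    rintro ⟨i, j⟩ _
    rw [sum_map, sum_product]
    rfl
  · simp_rw [Set.PairwiseDisjoint, Set.Pairwise, disjoint_left]
    aesop

theorem w_succ (k n : ℕ) : 2 * w k (n + 1) = ∑ j ∈ range (k + 1),
    (k.choose j : ℝ) * ∑ ij ∈ antidiagonal n, v j ij.1 * v (k - j) ij.2 := by
  simp only [w, sum_trees_succ, mul_sum (antidiagonal n)]
  rw [sum_comm]
  apply sum_congr rfl
  rintro ⟨i, i'⟩ _
  simp only [v]
  have : ∀ l r : BinaryTree Unit, Q (.node () l r) ^ k =
      ∑ j ∈ range (k + 1), Z l ^ j * Z r ^ (k - j) * (k.choose j : ℝ) := by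
    intro l r
    rw [← add_pow]; rfl
  simp only [this]
  have h2 : ∑ l ∈ treesOfNumNodesEq i, ∑ r ∈ treesOfNumNodesEq i', 
      ∑ j ∈ range (k + 1), Z l ^ j * Z r ^ (k - j) * (k.choose j : ℝ) =
      ∑ j ∈ range (k + 1), ((∑ l ∈ treesOfNumNodesEq i, Z l ^ j) * 
        (∑ r ∈ treesOfNumNodesEq i', Z r ^ (k - j))) * (k.choose j : ℝ) := by
    simp only [sum_mul_sum]
    simp only [sum_mul]
    symm
    rw [sum_comm]
    apply sum_congr rfl
    intro l _
    rw [sum_comm]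
  rw [h2, mul_sum, mul_sum]
  apply sum_congr rfl
  intro j _
  ring

theorem W_eq (k : ℕ) (hk : k ≠ 0) : 2 * W k = ∑ j ∈ range (k + 1),
    (k.choose j : ℝ⟦X⟧) * (V j * V (k - j)) := by
  have h : 2 * PowerSeries.mk (w k) = X * ∑ j ∈ range (k + 1),
      (k.choose j : ℝ⟦X⟧) * (PowerSeries.mk (v j) * PowerSeries.mk (v (k - j))) := by
    ext n
    rw [show (2 : ℝ⟦X⟧) = C 2 from (map_ofNat C 2).symm, coeff_C_mul, coeff_mk]
    cases n with
    | zero => simp [w, Q, hk]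
    | succ n =>
      rw [coeff_succ_X_mul, w_succ, map_sum]
      apply sum_congr rfl
      intro j _
      rw [← map_natCast (C (R := ℝ)), coeff_C_mul, coeff_mul]
      simp only [coeff_mk]
  have h2 := congrArg (fun f => X * f) h
  simp only [mul_sum] at h2
  calc 2 * W k = X * (2 * PowerSeries.mk (w k)) := by rw [W]; ring
    _ = _ := h2
    _ = _ := by
      apply sum_congr rfl
      intro j _
      simp only [V]
      ring

theorem W_zero : 2 * W 0 = 4 * X + V 0 * V 0 := by
  have h : 2 * PowerSeries.mk (w 0) = 4 + X * (PowerSeries.mk (v 0) * PowerSeries.mk (v 0)) := by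
    ext n
    rw [show (2 : ℝ⟦X⟧) = C 2 from (map_ofNat C 2).symm, show (4 : ℝ⟦X⟧) = C 4 from (map_ofNat C 4).symm, coeff_C_mul, coeff_mk,
      map_add, coeff_C]
    cases n with
    | zero => simp [w]; norm_num
    | succ n =>
      rw [coeff_succ_X_mul, w_succ, coeff_mul]
      simp
  calc 2 * W 0 = X * (2 * PowerSeries.mk (w 0)) := by rw [W]; ring
    _ = _ := by rw [h]; simp only [V]; ring

/-- twice the Euler operator -/
noncomputable def D : Derivation ℝ ℝ⟦X⟧ ℝ⟦X⟧ := (2 * X : ℝ⟦X⟧) • derivative ℝ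

theorem coeff_D (f : ℝ⟦X⟧) (n : ℕ) : coeff n (D f) = 2 * n * coeff n f := by
  have : D f = C 2 * (X * derivative ℝ f) := by
    rw [show C 2 = (2 : ℝ⟦X⟧) from map_ofNat C 2, ← mul_assoc]
    rfl
  rw [this, coeff_C_mul]
  cases n with
  | zero => simp
  | succ n => rw [coeff_succ_X_mul, coeff_derivative]; push_cast; ring

theorem coeff_Dit (f : ℝ⟦X⟧) (j n : ℕ) : coeff n (D^[j] f) = (2 * n) ^ j * coeff n f := by
  induction j with
  | zero => simp
  | succ j ih => rw [Function.iterate_succ_apply', coeff_D, ih]; ring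

theorem V_eq (k : ℕ) : V k = ∑ j ∈ range (k + 1),
    (k.choose j : ℝ⟦X⟧) * (D^[j] (W (k - j))) := by
  ext n
  rw [map_sum]
  have : ∀ j, coeff n ((k.choose j : ℝ⟦X⟧) * (D^[j] (W (k - j)))) =
      (k.choose j : ℝ) * ((2 * n) ^ j * coeff n (W (k - j))) := by
    intro j
    rw [← coeff_Dit, ← map_natCast (C (R := ℝ)), coeff_C_mul]
  simp only [this]
  cases n with
  | zero => simp [V, W]
  | succ n =>
    simp only [V, W, coeff_succ_X_mul, coeff_mk, v, w, mul_sum]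
    rw [sum_comm]
    apply sum_congr rfl
    intro t ht
    rw [mem_treesOfNumNodesEq] at ht
    rw [Z, ht, add_comm, add_pow, mul_sum]
    apply sum_congr rfl
    intro j _
    push_cast
    ring

/-- the square root of `1 - 4 X` -/
noncomputable def s : ℝ⟦X⟧ := 1 - V 0

/-- the inverse of `s` -/
noncomputable def r : ℝ⟦X⟧ := s⁻¹

theorem two_ne : (2 : ℝ⟦X⟧) ≠ 0 := by
  intro h
  have := congrArg (constantCoeff (R := ℝ)) h
  rw [map_ofNat, map_zero] at this
  norm_num at this

theorem rs : r * s = 1 := by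
  rw [mul_comm]
  apply PowerSeries.mul_inv_cancel
  simp [s, V]

theorem VW0 : V 0 = W 0 := by
  rw [V_eq]; simp

theorem s_sq : s ^ 2 = 1 - 4 * X := by
  have h := W_zero
  rw [← VW0] at h
  rw [s]
  linear_combination -h

theorem D_num (n : ℕ) [n.AtLeastTwo] : D (ofNat(n) : ℝ⟦X⟧) = 0 := by
  rw [← map_ofNat (algebraMap ℝ ℝ⟦X⟧)]
  exact D.map_algebraMap _

theorem Ds : D s = s - r := by
  have h := congrArg D s_sq
  have h1 : D (s ^ 2) = 2 * s * D s := by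
    rw [pow_two, D.leibniz]; simp only [smul_eq_mul]; ring
  have hX : D X = 2 * X := by
    ext n
    rw [coeff_D, show (2 : ℝ⟦X⟧) = C 2 from (map_ofNat C 2).symm, coeff_C_mul, coeff_X]
    split_ifs with h
    · simp [h]
    · simp
  have h2 : D (1 - 4 * X) = - 8 * X := by
    rw [map_sub, D.leibniz, hX, D.map_one_eq_zero, D_num]
    simp only [smul_eq_mul]
    ring
  rw [h1, h2] at h
  apply mul_left_cancel₀ two_ne
  linear_combination r * h - (2 * D s) * rs - 2 * r * s_sq + 2 * s * rs

theorem Dr : D r = r ^ 3 - r := by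
  have h := congrArg D rs
  rw [D.leibniz, D.map_one_eq_zero, Ds] at h
  simp only [smul_eq_mul] at h
  linear_combination r * h - (D r + r) * rs

theorem Dpow (m : ℕ) : D (r ^ m) = m * (r ^ (m + 2) - r ^ m) := by
  cases m with
  | zero => simp
  | succ m =>
    rw [D.leibniz_pow, Dr]
    simp only [smul_eq_mul, nsmul_eq_mul, Nat.add_sub_cancel]
    ring

theorem V0_eq : V 0 = 1 - s := by rw [s]; ring

theorem W0_eq : W 0 = 1 - s := by rw [← VW0, V0_eq]

theorem V1_eq : V 1 = r ^ 2 - 1 := by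
  have h1 := V_eq 1
  have h2 := W_eq 1 one_ne_zero
  simp [sum_range_succ, V0_eq, W0_eq, Ds] at h1 h2
  apply mul_left_cancel₀ two_ne
  linear_combination 2 * r * h1 + r * h2 - (2 * V 1 + 2) * rs

theorem W1_eq : W 1 = r ^ 2 - r - 1 + s := by
  have h2 := W_eq 1 one_ne_zero
  simp [sum_range_succ, V0_eq, V1_eq] at h2
  apply mul_left_cancel₀ two_ne
  linear_combination h2 - 2 * r * rs

theorem V2_eq : V 2 = 5 * r ^ 5 - r ^ 4 - 6 * r ^ 3 + r + 1 := by
  have h1 := V_eq 2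
  have h2 := W_eq 2 two_ne_zero
  simp [sum_range_succ, V0_eq, W0_eq, V1_eq, W1_eq, Ds, Dr] at h1 h2
  apply mul_left_cancel₀ two_ne
  linear_combination 2 * r * h1 + r * h2 - (2 * V 2 - 2) * rs

theorem W2_eq : W 2 = 5 * r ^ 5 - 5 * r ^ 4 - 5 * r ^ 3 + 4 * r ^ 2 + r + 1 - s := by
  have h2 := W_eq 2 two_ne_zero
  simp [sum_range_succ, V0_eq, V1_eq, V2_eq] at h2
  apply mul_left_cancel₀ two_ne
  linear_combination h2 - 2 * (5 * r ^ 4 - r ^ 3 - 6 * r ^ 2 + 1) * rs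

theorem V3_eq : V 3 = 90 * r ^ 8 - 39 * r ^ 7 - 159 * r ^ 6 + 51 * r ^ 5 + 75 * r ^ 4 - 9 * r ^ 3
    - 5 * r ^ 2 - 3 * r - 1 := by
  have h1 := V_eq 3
  have h2 := W_eq 3 three_ne_zero
  simp [sum_range_succ, V0_eq, W0_eq, V1_eq, W1_eq, V2_eq, W2_eq, Ds, Dr, D_num,
    Nat.choose] at h1 h2
  apply mul_left_cancel₀ two_ne
  linear_combination 2 * r * h1 + r * h2 - (2 * V 3 + 2) * rs

theorem W3_eq : W 3 = 90 * r ^ 8 - 114 * r ^ 7 - 123 * r ^ 6 + 177 * r ^ 5 + 27 * r ^ 4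
    - 63 * r ^ 3 + 7 * r ^ 2 - r - 1 + s := by
  have h2 := W_eq 3 three_ne_zero
  simp [sum_range_succ, V0_eq, V1_eq, V2_eq, V3_eq, Nat.choose] at h2
  apply mul_left_cancel₀ two_ne
  linear_combination h2 - 2 * (90 * r ^ 7 - 39 * r ^ 6 - 159 * r ^ 5 + 51 * r ^ 4 + 75 * r ^ 3
    - 9 * r ^ 2 - 5 * r - 3) * rs

theorem V4_eq : V 4 = 3315 * r ^ 11 - 2328 * r ^ 10 - 7533 * r ^ 9 + 4833 * r ^ 8 + 5466 * r ^ 7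
    - 2952 * r ^ 6 - 1282 * r ^ 5 + 422 * r ^ 4 + 27 * r ^ 3 + 24 * r ^ 2 + 7 * r + 1 := by
  have h1 := V_eq 4
  have h2 := W_eq 4 four_ne_zero
  simp [sum_range_succ, V0_eq, W0_eq, V1_eq, W1_eq, V2_eq, W2_eq, V3_eq, W3_eq, Ds, Dr, D_num, Nat.choose] at h1 h2
  apply mul_left_cancel₀ two_ne
  linear_combination 2 * r * h1 + r * h2 - (2 * V 4 - 2) * rs


/-- coefficient asymptotics relative to `catalan n * √(n+1) ^ N` -/
def Lim (N : ℕ) (f : ℝ⟦X⟧) (L : ℝ) : Prop :=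
  Tendsto (fun n : ℕ => coeff (n + 1) f / (catalan n * √((n : ℝ) + 1) ^ N)) atTop (nhds L)

theorem catalan_pos' (n : ℕ) : (0 : ℝ) < catalan n := by
  have h := succ_mul_catalan_eq_centralBinom n
  have h2 := Nat.centralBinom_pos n
  rw [← h] at h2
  exact_mod_cast Nat.pos_of_mul_pos_left h2

theorem Lim.add {N : ℕ} {f g : ℝ⟦X⟧} {a b : ℝ} (hf : Lim N f a) (hg : Lim N g b) :
    Lim N (f + g) (a + b) := by
  unfold Lim at *
  simpa [add_div] using Filter.Tendsto.add hf hg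

theorem Lim.nmul {N : ℕ} {f : ℝ⟦X⟧} {a : ℝ} (c : ℝ) (hf : Lim N f a) :
    Lim N (C c * f) (c * a) := by
  unfold Lim at *
  simpa [mul_div_assoc] using Filter.Tendsto.const_mul c hf

theorem sqrt_inv_tendsto : Tendsto (fun n : ℕ => (√((n : ℝ) + 1))⁻¹) atTop (nhds 0) := by
  apply Tendsto.comp tendsto_inv_atTop_zero
  apply Tendsto.comp tendsto_sqrt_atTop
  exact tendsto_atTop_add_const_right _ _ tendsto_natCast_atTop_atTop

theorem Lim.lift {N : ℕ} {f : ℝ⟦X⟧} {a : ℝ} (hf : Lim N f a) (M : ℕ) (h : N < M) :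
    Lim M f 0 := by
  unfold Lim at *
  obtain ⟨d, rfl⟩ := Nat.exists_eq_add_of_lt h
  have h2 := hf.mul (sqrt_inv_tendsto.pow (d + 1))
  simp only [ne_eq, Nat.add_eq_zero_iff, one_ne_zero, and_false, not_false_eq_true, zero_pow,
    mul_zero] at h2
  refine h2.congr fun n => ?_
  have : √((n : ℝ) + 1) ≠ 0 := by positivity
  have := (catalan_pos' n).ne'
  rw [inv_pow, add_assoc, pow_add √((n : ℝ) + 1) N]
  field_simp

theorem coeff_V (k n : ℕ) : coeff (n + 1) (V k) = v k n := by
  simp [V, coeff_succ_X_mul]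

theorem v_zero (n : ℕ) : v 0 n = 2 * catalan n := by
  simp [v, treesOfNumNodesEq_card_eq_catalan]

theorem coeff_s (n : ℕ) : coeff (n + 1) s = -2 * catalan n := by
  rw [s, map_sub, coeff_V, v_zero, coeff_one]
  simp

theorem coeff_r (n : ℕ) : coeff (n + 1) r = 2 * (2 * n + 1) * catalan n := by
  have h := congrArg (coeff (n + 1)) Ds
  rw [coeff_D, map_sub, coeff_s] at h
  push_cast at h
  linarith

theorem coeff_rpow (m n : ℕ) (hm : m ≠ 0) :
    coeff (n + 1) (r ^ (m + 2)) = (2 * (n + 1) + m) / m * coeff (n + 1) (r ^ m) := by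
  have h := congrArg (coeff (n + 1)) (Dpow m)
  rw [coeff_D, ← map_natCast (C (R := ℝ)), coeff_C_mul, map_sub] at h
  have : (m : ℝ) ≠ 0 := by exact_mod_cast hm
  push_cast at h
  field_simp
  linarith

theorem inv_tendsto : Tendsto (fun n : ℕ => ((n : ℝ) + 1)⁻¹) atTop (nhds 0) := by
  simpa using tendsto_one_div_add_atTop_nhds_zero_nat (𝕜 := ℝ)

theorem Lim.step {N m : ℕ} {a : ℝ} (hm : m ≠ 0) (hf : Lim N (r ^ m) a) :
    Lim (N + 2) (r ^ (m + 2)) (2 / m * a) := by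
  unfold Lim at *
  have h2 := ((inv_tendsto.add_const (2 / (m : ℝ))).mul hf)
  rw [zero_add] at h2
  refine h2.congr fun n => ?_
  have h3 : √((n : ℝ) + 1) ≠ 0 := by positivity
  have := (catalan_pos' n).ne'
  have h4 : √((n : ℝ) + 1) ^ 2 = n + 1 := Real.sq_sqrt (by positivity)
  have : (m : ℝ) ≠ 0 := by exact_mod_cast hm
  have : (n : ℝ) + 1 ≠ 0 := by positivity
  rw [coeff_rpow m n hm, pow_add, h4]
  field_simp
  ring

theorem Lim_zero : Lim 1 (1 : ℝ⟦X⟧) 0 := by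
  unfold Lim
  simp [coeff_one]

theorem Lim_one : Lim 2 (r ^ 1) 4 := by
  unfold Lim
  have h2 := (inv_tendsto.const_mul (-2)).const_add 4
  rw [mul_zero, add_zero] at h2
  refine h2.congr fun n => ?_
  have := (catalan_pos' n).ne'
  have h4 : √((n : ℝ) + 1) ^ 2 = n + 1 := Real.sq_sqrt (by positivity)
  rw [pow_one, coeff_r, h4]
  have : (n : ℝ) + 1 ≠ 0 := by positivity
  field_simp
  ring

theorem coeff_r2 (n : ℕ) : coeff n (r ^ 2) = 4 ^ n := by
  have h1 : r ^ 2 * (1 - 4 * X) = 1 := by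
    linear_combination (1 + r * s) * rs - r ^ 2 * s_sq
  have h2 : ∀ f : ℝ⟦X⟧, f * (1 - 4 * X) = f - C 4 * (X * f) := by
    intro f
    rw [show C 4 = (4 : ℝ⟦X⟧) from map_ofNat C 4]; ring
  rw [h2] at h1
  induction n with
  | zero =>
    have := congrArg (coeff 0) h1
    simpa [sub_eq_zero] using this
  | succ n ih =>
    have := congrArg (coeff (n + 1)) h1
    rw [map_sub, coeff_C_mul, coeff_succ_X_mul, ih, coeff_one] at this
    simp at this
    rw [pow_succ (4 : ℝ) n]; linarith

theorem Lim_two : Lim 3 (r ^ 2) (4 * √π) := by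
  unfold Lim
  have h1 : Tendsto (fun n : ℕ => 4 * √(Real.Wallis.W n * (2 + (-1) * ((n : ℝ) + 1)⁻¹))) atTop
      (nhds (4 * √π)) := by
    have h0 := Real.Wallis.tendsto_W_nhds_pi_div_two.mul ((inv_tendsto.const_mul (-1)).const_add 2)
    rw [mul_zero, add_zero, div_mul_cancel₀ _ (two_ne_zero)] at h0
    exact (h0.sqrt).const_mul 4
  refine h1.congr fun n => ?_
  have hc := (catalan_pos' n)
  have h4 : √((n : ℝ) + 1) ^ 2 = n + 1 := Real.sq_sqrt (by positivity)
  have h5 : ((n : ℝ) + 1) * catalan n = n.centralBinom := by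
    exact_mod_cast succ_mul_catalan_eq_centralBinom n
  have h6 : (n.centralBinom : ℝ) * (n.factorial) ^ 2 = ((2 * n).factorial : ℝ) := by
    have := Nat.choose_mul_factorial_mul_factorial (show n ≤ 2 * n by omega)
    rw [show 2 * n - n = n by omega] at this
    rw [Nat.centralBinom, pow_two, ← mul_assoc]
    exact_mod_cast this
  rw [coeff_r2]
  have h7 : √(Real.Wallis.W n * (2 + (-1) * ((n : ℝ) + 1)⁻¹)) =
      4 ^ n / (catalan n * √((n : ℝ) + 1) ^ 3) := by
    rw [Real.sqrt_eq_iff_mul_self_eq_of_pos (by positivity), Real.Wallis.W_eq_factorial_ratio,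
      ← h6, ← h5]
    have : (n : ℝ) + 1 ≠ 0 := by positivity
    have h8 : (n.factorial : ℝ) ≠ 0 := by positivity
    have h9 : (√((n : ℝ) + 1) ^ 3) * (√((n : ℝ) + 1) ^ 3) = (n + 1) ^ 3 := by
      calc _ = (√((n : ℝ) + 1) ^ 2) ^ 3 := by ring
        _ = _ := by rw [h4]
    have h10 : (2 : ℝ) ^ (4 * n) = 4 ^ n * 4 ^ n := by
      rw [← mul_pow, pow_mul]; norm_num
    rw [div_mul_div_comm, mul_mul_mul_comm (catalan n : ℝ), h9, h10]
    field_simp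
    ring
  rw [h7, pow_succ]
  ring

theorem Lim_pows :
    Lim 4 (r ^ 3) 8 ∧ Lim 6 (r ^ 5) (16 / 3) ∧ Lim 8 (r ^ 7) (32 / 15) ∧
    Lim 10 (r ^ 9) (64 / 105) ∧ Lim 12 (r ^ 11) (128 / 945) ∧
    Lim 5 (r ^ 4) (4 * √π) ∧ Lim 7 (r ^ 6) (2 * √π) ∧ Lim 9 (r ^ 8) (2 / 3 * √π) ∧
    ∃ L, Lim 11 (r ^ 10) L := by
  have h3 := Lim_one.step (by norm_num)
  have h5 := h3.step (by norm_num)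
  have h7 := h5.step (by norm_num)
  have h9 := h7.step (by norm_num)
  have h11 := h9.step (by norm_num)
  have h4 := Lim_two.step (by norm_num)
  have h6 := h4.step (by norm_num)
  have h8 := h6.step (by norm_num)
  have h10 := h8.step (by norm_num)
  refine ⟨?_, ?_, ?_, ?_, ?_, ?_, ?_, ?_, _, h10⟩
  · convert h3 using 1; norm_num
  · convert h5 using 1; norm_num
  · convert h7 using 1; norm_num
  · convert h9 using 1; norm_num
  · convert h11 using 1; norm_num
  · convert h4 using 1; norm_num
  · convert h6 using 1; push_cast; ring
  · convert h8 using 1; push_cast; ring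

theorem Lim_V1 : Lim 3 (V 1) (4 * √π) := by
  have h := Lim_two.add ((Lim_zero.lift 3 (by norm_num)).nmul (-1))
  convert h using 1
  · rw [V1_eq, map_neg, map_one]; ring
  · ring

theorem Lim_V2 : Lim 6 (V 2) (80 / 3) := by
  obtain ⟨h3, h5, h7, h9, h11, h4, h6, h8, L, h10⟩ := Lim_pows
  have h := (h5.nmul 5).add (((h4.lift 6 (by norm_num)).nmul (-1)).add
    (((h3.lift 6 (by norm_num)).nmul (-6)).add
    (((Lim_one.lift 6 (by norm_num))).add
    ((Lim_zero.lift 6 (by norm_num))))))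
  convert h using 1
  · rw [V2_eq]; simp only [map_neg, map_one, map_ofNat]; ring
  · norm_num

theorem Lim_V3 : Lim 9 (V 3) (60 * √π) := by
  obtain ⟨h3, h5, h7, h9, h11, h4, h6, h8, L, h10⟩ := Lim_pows
  have h := (h8.nmul 90).add (((h7.lift 9 (by norm_num)).nmul (-39)).add
    (((h6.lift 9 (by norm_num)).nmul (-159)).add
    (((h5.lift 9 (by norm_num)).nmul 51).add
    (((h4.lift 9 (by norm_num)).nmul 75).add
    (((h3.lift 9 (by norm_num)).nmul (-9)).add
    (((Lim_two.lift 9 (by norm_num)).nmul (-5)).add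
    (((Lim_one.lift 9 (by norm_num)).nmul (-3)).add
    ((Lim_zero.lift 9 (by norm_num)).nmul (-1)))))))))
  convert h using 1
  · rw [V3_eq]; simp only [map_neg, map_one, map_ofNat]; ring
  · ring

theorem Lim_V4 : Lim 12 (V 4) (3315 * 128 / 945) := by
  obtain ⟨h3, h5, h7, h9, h11, h4, h6, h8, L, h10⟩ := Lim_pows
  have h := (h11.nmul 3315).add (((h10.lift 12 (by norm_num)).nmul (-2328)).add
    (((h9.lift 12 (by norm_num)).nmul (-7533)).add
    (((h8.lift 12 (by norm_num)).nmul 4833).add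
    (((h7.lift 12 (by norm_num)).nmul 5466).add
    (((h6.lift 12 (by norm_num)).nmul (-2952)).add
    (((h5.lift 12 (by norm_num)).nmul (-1282)).add
    (((h4.lift 12 (by norm_num)).nmul 422).add
    (((h3.lift 12 (by norm_num)).nmul 27).add
    (((Lim_two.lift 12 (by norm_num)).nmul 24).add
    (((Lim_one.lift 12 (by norm_num)).nmul 7).add
    (Lim_zero.lift 12 (by norm_num))))))))))))
  convert h using 1
  · rw [V4_eq]; simp only [map_neg, map_one, map_ofNat]; ring
  · norm_num

/-- normalised moments -/
noncomputable def e (k n : ℕ) : ℝ := v k n / (2 * catalan n * √((n : ℝ) + 1) ^ (3 * k))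

theorem e_tendsto {k : ℕ} {L : ℝ} (h : Lim (3 * k) (V k) L) :
    Tendsto (e k) atTop (nhds (L / 2)) := by
  refine (Filter.Tendsto.div_const h 2).congr fun n => ?_
  rw [coeff_V, e, div_div]
  congr 1
  ring

theorem sum_Z (k n : ℕ) : ∑ t ∈ treesOfNumNodesEq n, Z t ^ k =
    e k n * catalan n * √((n : ℝ) + 1) ^ (3 * k) := by
  have h3 : √((n : ℝ) + 1) ≠ 0 := by positivity
  have := (catalan_pos' n).ne'
  rw [e, v]
  field_simp

theorem sum_T (T : ℕ → Finset PTree)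
    (hT : ∀ n : ℕ, ∀ t : PTree, t ∈ T n ↔ t.size = 2 * n + 1 ∧ t.validDeg {2}) (n : ℕ)
    (F : ℝ → ℝ) : ∑ t ∈ T n, F (t.totalHeight : ℝ) =
      ∑ t ∈ treesOfNumNodesEq n, F (Z t - (4 * n + 2)) := by
  rw [T_eq T hT, sum_map]
  apply sum_congr rfl
  intro t ht
  rw [mem_treesOfNumNodesEq] at ht
  simp only [Function.Embedding.coeFn_mk]
  rw [height_emb, ht]

theorem card_T (T : ℕ → Finset PTree)
    (hT : ∀ n : ℕ, ∀ t : PTree, t ∈ T n ↔ t.size = 2 * n + 1 ∧ t.validDeg {2}) (n : ℕ) :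
    ((T n).card : ℝ) = catalan n := by
  rw [T_eq T hT, card_map, treesOfNumNodesEq_card_eq_catalan]

theorem sum_one (n : ℕ) : ∑ _t ∈ treesOfNumNodesEq n, (1 : ℝ) = catalan n := by
  simp [treesOfNumNodesEq_card_eq_catalan]


end TH

/-- Let `H_n` be the total height (sum over all vertices of the distance to the root) on
complete binary trees with `2n+1` vertices, under the uniform distribution; with mean
`μ n`, central moments `m i n`, and scaled moments `α i n = m i n / (m 2 n)^(i/2)`,
the `4`-th scaled moment converges as `n → ∞` to the stated constant. -/
theorem totalheight_stmt8 (T : ℕ → Finset PTree)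
    (hT : ∀ n : ℕ, ∀ t : PTree, t ∈ T n ↔ t.size = 2 * n + 1 ∧ t.validDeg {2})
    (μ : ℕ → ℝ)
    (hμ : ∀ n : ℕ, μ n = (∑ t ∈ T n, (t.totalHeight : ℝ)) / ((T n).card : ℝ))
    (m : ℕ → ℕ → ℝ)
    (hm : ∀ i n : ℕ, m i n =
      (∑ t ∈ T n, ((t.totalHeight : ℝ) - μ n) ^ i) / ((T n).card : ℝ))
    (α : ℕ → ℕ → ℝ)
    (hα : ∀ i n : ℕ, α i n = m i n / (m 2 n) ^ ((i : ℝ) / 2)) :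
    Tendsto (fun n : ℕ => α 4 n) atTop
      (nhds ((-189 * π ^ 2 + 315 * π + 884) / (7 * (10 - 3 * π) ^ 2))) := by
  open TH in
  have hmu : ∀ n, μ n = e 1 n * √((n : ℝ) + 1) ^ 3 - (4 * n + 2) := by
    intro n
    have hc := (catalan_pos' n).ne'
    have h1 := sum_Z 1 n
    simp only [pow_one, mul_one] at h1
    rw [hμ, sum_T T hT n (fun x => x), card_T T hT, Finset.sum_sub_distrib, h1]
    simp only [Finset.sum_const, BinaryTree.treesOfNumNodesEq_card_eq_catalan, nsmul_eq_mul]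
    field_simp
  open TH in
  have hmi : ∀ i n, m i n = (∑ t ∈ BinaryTree.treesOfNumNodesEq n,
      (Z t - e 1 n * √((n : ℝ) + 1) ^ 3) ^ i) / catalan n := by
    intro i n
    rw [hm, sum_T T hT n (fun x => (x - μ n) ^ i), card_T T hT, hmu]
    congr 1
    apply Finset.sum_congr rfl
    intro t _
    congr 1
    ring
  open TH in
  have h2 : ∀ n, m 2 n = √((n : ℝ) + 1) ^ 6 * (e 2 n - e 1 n ^ 2) := by
    intro n
    have hc := (catalan_pos' n).ne'
    have hz1 := sum_Z 1 n
    have hz2 := sum_Z 2 n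
    simp only [pow_one, mul_one] at hz1
    rw [hmi, div_eq_iff hc]
    have : ∀ t, (Z t - e 1 n * √((n : ℝ) + 1) ^ 3) ^ 2 = Z t ^ 2 
        - 2 * (e 1 n * √((n : ℝ) + 1) ^ 3) * Z t + (e 1 n * √((n : ℝ) + 1) ^ 3) ^ 2 * 1 := by
      intro t; ring
    simp only [this, Finset.sum_add_distrib, Finset.sum_sub_distrib, ← Finset.mul_sum, hz1, hz2,
      sum_one]
    ring
  open TH in
  have h4 : ∀ n, m 4 n = √((n : ℝ) + 1) ^ 12 *
      (e 4 n - 4 * e 3 n * e 1 n + 6 * e 2 n * e 1 n ^ 2 - 3 * e 1 n ^ 4) := by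
    intro n
    have hc := (catalan_pos' n).ne'
    have hz1 := sum_Z 1 n
    have hz2 := sum_Z 2 n
    have hz3 := sum_Z 3 n
    have hz4 := sum_Z 4 n
    simp only [pow_one, mul_one] at hz1
    rw [hmi, div_eq_iff hc]
    have : ∀ t, (Z t - e 1 n * √((n : ℝ) + 1) ^ 3) ^ 4 = Z t ^ 4 
        - 4 * (e 1 n * √((n : ℝ) + 1) ^ 3) * Z t ^ 3
        + 6 * (e 1 n * √((n : ℝ) + 1) ^ 3) ^ 2 * Z t ^ 2
        - 4 * (e 1 n * √((n : ℝ) + 1) ^ 3) ^ 3 * Z t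
        + (e 1 n * √((n : ℝ) + 1) ^ 3) ^ 4 * 1 := by
      intro t; ring
    simp only [this, Finset.sum_add_distrib, Finset.sum_sub_distrib, ← Finset.mul_sum, hz1, hz2,
      hz3, hz4, sum_one]
    ring
  open TH in
  have hα4 : ∀ n, (e 4 n - 4 * e 3 n * e 1 n + 6 * e 2 n * e 1 n ^ 2 - 3 * e 1 n ^ 4) /
      (e 2 n - e 1 n ^ 2) ^ 2 = α 4 n := by
    intro n
    have h3 : √((n : ℝ) + 1) ^ 12 ≠ 0 := by positivity
    rw [hα, show ((4 : ℕ) : ℝ) / 2 = ((2 : ℕ) : ℝ) by norm_num, Real.rpow_natCast, h2, h4,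
      mul_pow, ← pow_mul]
    rw [mul_div_mul_left _ _ h3]
  refine Tendsto.congr hα4 ?_
  have t1 := TH.e_tendsto (k := 1) TH.Lim_V1
  have t2 := TH.e_tendsto (k := 2) TH.Lim_V2
  have t3 := TH.e_tendsto (k := 3) TH.Lim_V3
  have t4 := TH.e_tendsto (k := 4) TH.Lim_V4
  have hpi : √π ^ 2 = π := Real.sq_sqrt Real.pi_pos.le
  have hpos : 10 - 3 * π ≠ 0 := by
    have := Real.pi_lt_d2
    intro h; linarith
  have hd : (80 / 3 / 2 - (4 * √π / 2) ^ 2) ^ 2 ≠ 0 := by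
    rw [div_pow, mul_pow, hpi]
    intro h
    apply hpos
    have := pow_eq_zero_iff (two_ne_zero) |>.1 h
    linarith
  have key := (((t4.sub ((t3.const_mul 4).mul t1)).add ((t2.const_mul 6).mul (t1.pow 2))).sub
    ((t1.pow 4).const_mul 3)).div ((t2.sub (t1.pow 2)).pow 2) hd
  refine key.trans (le_of_eq ?_)
  congr 1
  rw [div_eq_div_iff hd (mul_ne_zero (by norm_num) (pow_ne_zero _ hpos))]
  have gen : ∀ q p : ℝ, q ^ 2 = p →
      (3315 * 128 / 945 / 2 - 4 * (60 * q / 2) * (4 * q / 2) + 6 * (80 / 3 / 2) * (4 * q / 2) ^ 2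
        - 3 * (4 * q / 2) ^ 4) * (7 * (10 - 3 * p) ^ 2) =
      (-189 * p ^ 2 + 315 * p + 884) * (80 / 3 / 2 - (4 * q / 2) ^ 2) ^ 2 := by
    rintro q p rfl
    ring
  exact gen _ _ hpi
end

section
/- For n ≥ 1, let H_n be the random variable 'total height' (sum over all vertices of the distance to the root) on the set of complete binary trees with 2n+1 vertices, equipped with the uniform distribution. Let μ(n) = E[H_n], m_i(n) = E[(H_n − μ(n))^i], and α_i(n) = m_i(n)/m_2(n)^{i/2}. Then lim_{n→∞} α_5(n) = (36π² + (75/2)π − 105845/224)·√3·√(π/(10 − 3π)) / (10 − 3π)² ≈ 7.2563753582799571…. -/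
namespace TotH

open BinaryTree Finset PowerSeries

/-- `K t` = total height plus twice the number of internal nodes. -/
noncomputable def K : BinaryTree Unit → ℝ
  | nil => 0
  | node _ a b => K a + K b + 2 * ((a.numNodes : ℝ) + b.numNodes + 2)

/-- Embedding of binary trees into plane trees. -/
def toP : BinaryTree Unit → PTree
  | nil => PTree.node []
  | node _ a b => PTree.node [toP a, toP b]

lemma toP_inj : Function.Injective toP := by
  intro a
  induction a with
  | nil => intro b h; cases b <;> simp_all [toP]
  | node v l r hl hr =>
    intro b h
    cases b with
    | nil => simp [toP] at h
    | node w l' r' =>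
      simp only [toP, PTree.node.injEq, List.cons.injEq, and_true] at h
      rw [hl h.1, hr h.2]

lemma size_toP (t : BinaryTree Unit) : (toP t).size = 2 * t.numNodes + 1 := by
  induction t with
  | nil => simp [toP, PTree.size]
  | node v l r hl hr =>
    rw [toP, PTree.size]
    simp [hl, hr]; ring

lemma totalHeight_toP (t : BinaryTree Unit) :
    ((toP t).totalHeight : ℝ) = K t - 2 * t.numNodes := by
  induction t with
  | nil => simp [toP, PTree.totalHeight, K]
  | node v l r hl hr =>
    rw [toP, PTree.totalHeight]
    simp [hl, hr, size_toP, K]; ring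

lemma valid_toP (t : BinaryTree Unit) : (toP t).validDeg {2} := by
  induction t with
  | nil => simp [toP, PTree.validDeg]
  | node v l r hl hr =>
    rw [toP, PTree.validDeg]
    simp [hl, hr]

lemma exists_toP : ∀ t : PTree, t.validDeg {2} → ∃ b, toP b = t
  | PTree.node ts => by
    intro h
    rw [PTree.validDeg] at h
    obtain ⟨h1, h2⟩ := h
    rcases h1 with h1 | h1
    · exact ⟨nil, by simp [toP, h1]⟩
    · simp only [Finset.mem_singleton] at h1
      obtain ⟨a, b, rfl⟩ := List.length_eq_two.1 h1
      obtain ⟨x, hx⟩ := exists_toP a (h2 a (by simp))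
      obtain ⟨y, hy⟩ := exists_toP b (h2 b (by simp))
      exact ⟨node () x y, by simp [toP, hx, hy]⟩

lemma T_eq (T : ℕ → Finset PTree)
    (hT : ∀ n : ℕ, ∀ t : PTree, t ∈ T n ↔ t.size = 2 * n + 1 ∧ t.validDeg {2}) (n : ℕ) :
    T n = (treesOfNumNodesEq n).map ⟨toP, toP_inj⟩ := by
  ext t
  rw [hT, Finset.mem_map]
  constructor
  · rintro ⟨h1, h2⟩
    obtain ⟨b, rfl⟩ := exists_toP t h2
    rw [size_toP] at h1
    exact ⟨b, mem_treesOfNumNodesEq.2 (by omega), rfl⟩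
  · rintro ⟨b, hb, rfl⟩
    rw [mem_treesOfNumNodesEq] at hb
    simp only [Function.Embedding.coeFn_mk]
    exact ⟨by rw [size_toP, hb], valid_toP b⟩

/-- Raw power sums. -/
noncomputable def S (k n : ℕ) : ℝ := ∑ t ∈ treesOfNumNodesEq n, K t ^ k

lemma sum_succ (f : BinaryTree Unit → ℝ) (n : ℕ) :
    ∑ t ∈ treesOfNumNodesEq (n + 1), f t = ∑ ij ∈ antidiagonal n,
      ∑ a ∈ treesOfNumNodesEq ij.1, ∑ b ∈ treesOfNumNodesEq ij.2, f (node () a b) := by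
  rw [treesOfNumNodesEq_succ, Finset.sum_biUnion]
  · refine Finset.sum_congr rfl fun ij _ => ?_
    rw [pairwiseNode, Finset.sum_map, Finset.sum_product]
    rfl
  · simp_rw [Set.PairwiseDisjoint, Set.Pairwise, Function.onFun, disjoint_left]
    intro i _ j _ hij t ht1 ht2
    simp only [pairwiseNode, Finset.mem_map, Finset.mem_product, mem_treesOfNumNodesEq] at ht1 ht2
    obtain ⟨⟨a, b⟩, ⟨h1, h2⟩, rfl⟩ := ht1
    obtain ⟨⟨c, d⟩, ⟨h3, h4⟩, h5⟩ := ht2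
    simp at h5
    apply hij
    ext
    · rw [← h1, ← h3, h5.1]
    · rw [← h2, ← h4, h5.2]

lemma sum_shift_succ (k n : ℕ) :
    ∑ t ∈ treesOfNumNodesEq (n + 1), (K t - 2 * ((n : ℝ) + 2)) ^ k =
      ∑ ij ∈ antidiagonal n, ∑ i ∈ range (k + 1),
        (k.choose i : ℝ) * (S i ij.1 * S (k - i) ij.2) := by
  rw [sum_succ]
  refine Finset.sum_congr rfl fun ij hij => ?_
  have hn : ((ij.1 : ℝ) + ij.2) = n := by
    rw [← Finset.HasAntidiagonal.mem_antidiagonal.1 hij]; push_cast; ring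
  calc _ = ∑ a ∈ treesOfNumNodesEq ij.1, ∑ b ∈ treesOfNumNodesEq ij.2,
        ∑ i ∈ range (k + 1), K a ^ i * K b ^ (k - i) * (k.choose i : ℝ) := by
        refine Finset.sum_congr rfl fun a ha => Finset.sum_congr rfl fun b hb => ?_
        rw [← add_pow, K, mem_treesOfNumNodesEq.1 ha, mem_treesOfNumNodesEq.1 hb, hn]
        congr 1; ring
    _ = ∑ i ∈ range (k + 1), ∑ a ∈ treesOfNumNodesEq ij.1, ∑ b ∈ treesOfNumNodesEq ij.2,
         K a ^ i * K b ^ (k - i) * (k.choose i : ℝ) := by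
        rw [Finset.sum_comm]
        simp_rw [Finset.sum_comm (s := treesOfNumNodesEq ij.1) (t := range (k + 1))]
        rw [Finset.sum_comm]
        simp_rw [Finset.sum_comm (s := treesOfNumNodesEq ij.2) (t := treesOfNumNodesEq ij.1)]
    _ = _ := by
        refine Finset.sum_congr rfl fun i _ => ?_
        rw [S, S, Finset.sum_mul_sum, Finset.mul_sum]
        refine Finset.sum_congr rfl fun a _ => ?_
        rw [Finset.mul_sum]
        refine Finset.sum_congr rfl fun b _ => ?_
        ring

/-- The derivation `2 x d/dx`. -/
noncomputable def δ : Derivation ℝ ℝ⟦X⟧ ℝ⟦X⟧ := (2 * X : ℝ⟦X⟧) • PowerSeries.derivative ℝ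

lemma coeff_δ (f : ℝ⟦X⟧) (n : ℕ) : coeff n (δ f) = 2 * n * coeff n f := by
  have : δ f = 2 * (X * PowerSeries.derivative ℝ f) := by
    simp [δ, mul_assoc]
  rw [this, show (2 : ℝ⟦X⟧) = C 2 from (map_ofNat C 2).symm, coeff_C_mul]
  cases n with
  | zero => simp
  | succ n => rw [coeff_succ_X_mul, coeff_derivative]; push_cast; ring

lemma coeff_δ_iter (j : ℕ) (f : ℝ⟦X⟧) (n : ℕ) :
    coeff n (δ^[j] f) = (2 * n) ^ j * coeff n f := by
  induction j with
  | zero => simp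
  | succ j ih => rw [Function.iterate_succ_apply', coeff_δ, ih]; ring

/-- Generating functions (doubled, by number of leaves). -/
noncomputable def B (k : ℕ) : ℝ⟦X⟧ := 2 * (X * PowerSeries.mk (S k))

lemma coeff_B_succ (k n : ℕ) : coeff (n + 1) (B k) = 2 * S k n := by
  rw [B, show (2 : ℝ⟦X⟧) = C 2 from (map_ofNat C 2).symm, coeff_C_mul, coeff_succ_X_mul, coeff_mk]

lemma coeff_B_zero (k : ℕ) : coeff 0 (B k) = 0 := by
  simp [B]

lemma S_zero (k : ℕ) : S k 0 = 0 ^ k := by simp [S, K]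

lemma B_rec (k : ℕ) :
    2 * ∑ j ∈ range (k + 1), (-1 : ℝ⟦X⟧) ^ j * (k.choose j : ℝ⟦X⟧) * δ^[j] (B (k - j)) =
      4 * (-2) ^ k * X + ∑ i ∈ range (k + 1), (k.choose i : ℝ⟦X⟧) * (B i * B (k - i)) := by
  have hL : ∀ n, coeff (n + 1) (∑ j ∈ range (k + 1), (-1 : ℝ⟦X⟧) ^ j * (k.choose j : ℝ⟦X⟧) *
      δ^[j] (B (k - j))) = 2 * ∑ t ∈ treesOfNumNodesEq n, (K t - 2 * ((n : ℝ) + 1)) ^ k := by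
    intro n
    rw [map_sum]
    have : ∀ j, coeff (n + 1) ((-1 : ℝ⟦X⟧) ^ j * (k.choose j : ℝ⟦X⟧) * δ^[j] (B (k - j))) =
        2 * ∑ t ∈ treesOfNumNodesEq n,
          (-(2 * ((n : ℝ) + 1))) ^ j * K t ^ (k - j) * (k.choose j : ℝ) := by
      intro j
      rw [show (-1 : ℝ⟦X⟧) ^ j * (k.choose j : ℝ⟦X⟧) = C ((-1) ^ j * (k.choose j : ℝ)) by simp,
        coeff_C_mul, coeff_δ_iter, coeff_B_succ, S, Finset.mul_sum, Finset.mul_sum, Finset.mul_sum,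
        Finset.mul_sum]
      refine Finset.sum_congr rfl fun t _ => ?_
      rw [neg_pow (2 * ((n : ℝ) + 1))]
      push_cast; ring
    simp_rw [this]
    rw [← Finset.mul_sum, Finset.sum_comm]
    congr 1
    refine Finset.sum_congr rfl fun t _ => ?_
    rw [← add_pow]; congr 1; ring
  have hR : ∑ i ∈ range (k + 1), (k.choose i : ℝ⟦X⟧) * (B i * B (k - i)) =
      4 * (X * (X * ∑ i ∈ range (k + 1), (k.choose i : ℝ⟦X⟧) * (PowerSeries.mk (S i) * PowerSeries.mk (S (k - i))))) := by
    rw [Finset.mul_sum, Finset.mul_sum, Finset.mul_sum]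
    refine Finset.sum_congr rfl fun i _ => ?_
    simp only [B]; ring
  rw [hR]
  have e4 : (4 : ℝ⟦X⟧) = C 4 := (map_ofNat C 4).symm
  have e2 : (2 : ℝ⟦X⟧) = C 2 := (map_ofNat C 2).symm
  have e3 : (4 * (-2) ^ k : ℝ⟦X⟧) = C (4 * (-2) ^ k) := by
    rw [map_mul, map_pow, map_neg, ← e2, ← e4]
  rw [e3]
  ext n
  rw [map_add, e4, coeff_C_mul, coeff_C_mul, e2, coeff_C_mul]
  rcases n with _ | _ | n
  · rw [map_sum, Finset.sum_eq_zero]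
    · simp
    · intro j _
      rw [show (-1 : ℝ⟦X⟧) ^ j * (k.choose j : ℝ⟦X⟧) = C ((-1) ^ j * (k.choose j : ℝ)) by simp,
        coeff_C_mul, coeff_δ_iter, coeff_B_zero]; simp
  · rw [hL]
    simp [K, coeff_succ_X_mul, coeff_zero_X_mul]
    ring
  · rw [hL, coeff_succ_X_mul, coeff_succ_X_mul, map_sum]
    push_cast
    rw [show (n : ℝ) + 1 + 1 = n + 2 by ring, sum_shift_succ, coeff_X, if_neg (by omega),
      Finset.sum_comm, Finset.mul_sum, Finset.mul_sum, Finset.mul_sum, mul_zero, zero_add]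
    refine Finset.sum_congr rfl fun i _ => ?_
    rw [show (k.choose i : ℝ⟦X⟧) = C (k.choose i : ℝ) by simp, coeff_C_mul, coeff_mul]
    simp only [coeff_mk]
    rw [← Finset.mul_sum]; ring

/-- `s = sqrt(1-4x)`. -/
noncomputable def s : ℝ⟦X⟧ := 1 - B 0

/-- `r = 1/s`. -/
noncomputable def r : ℝ⟦X⟧ := s⁻¹

lemma s_sq : s ^ 2 = 1 - 4 * X := by
  have h := B_rec 0
  simp at h
  rw [s]
  linear_combination -h

lemma rs : r * s = 1 := by
  rw [r]
  apply PowerSeries.inv_mul_cancel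
  rw [s, map_sub, ← coeff_zero_eq_constantCoeff_apply, ← coeff_zero_eq_constantCoeff_apply,
    coeff_B_zero]
  simp

lemma δ_X : δ X = 2 * X := by simp [δ]

lemma δ_num (n : ℕ) [n.AtLeastTwo] (f : ℝ⟦X⟧) :
    δ (ofNat(n) * f) = ofNat(n) * δ f := by
  rw [Derivation.leibniz]
  have : δ (ofNat(n) : ℝ⟦X⟧) = 0 := by
    rw [← Nat.cast_ofNat]; exact Derivation.map_natCast _ _
  simp [this]

lemma δ_s : δ s = s - r := by
  have h := congrArg δ s_sq
  rw [pow_two, Derivation.leibniz, map_sub, δ_num, δ_X, Derivation.map_one_eq_zero] at h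
  simp only [smul_eq_mul] at h
  have h2 : 2 * δ s = 2 * (s - r) := by
    linear_combination r * h - 2 * δ s * rs - 2 * r * s_sq + 2 * s * rs
  have : (2 : ℝ⟦X⟧) ≠ 0 := by
    intro h0
    have := congrArg (coeff 0) h0
    rw [show (2 : ℝ⟦X⟧) = C 2 from (map_ofNat C 2).symm, coeff_zero_C] at this
    simp at this
  exact mul_left_cancel₀ this h2

lemma δ_r : δ r = r ^ 3 - r := by
  have h := congrArg δ rs
  rw [Derivation.leibniz, Derivation.map_one_eq_zero, δ_s] at h
  simp only [smul_eq_mul] at h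
  linear_combination r * h - δ r * rs - r * rs

lemma δ_r_pow (j : ℕ) : δ (r ^ j) = j * (r ^ (j + 2) - r ^ j) := by
  induction j with
  | zero => simp
  | succ j ih =>
    rw [pow_succ, Derivation.leibniz, ih, δ_r]
    simp only [smul_eq_mul]
    push_cast; ring


set_option linter.unusedSimpArgs false
set_option linter.unusedTactic false
set_option linter.unreachableTactic false

lemma δ_c (n : ℕ) [n.AtLeastTwo] : δ (ofNat(n) : ℝ⟦X⟧) = 0 := by
  rw [← Nat.cast_ofNat]; exact Derivation.map_natCast _ _

lemma two_cancel {f g : ℝ⟦X⟧} (h : 2 * f = 2 * g) : f = g := by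
  have : (2 : ℝ⟦X⟧) ≠ 0 := by
    intro h0
    have := congrArg (coeff 0) h0
    rw [show (2 : ℝ⟦X⟧) = C 2 from (map_ofNat C 2).symm, coeff_zero_C] at this
    simp at this
  exact mul_left_cancel₀ this h

lemma B0 : B 0 = 1 - s := by rw [s]; ring

lemma D1B0 : δ (B 0) =
      r ^ 1 - s := by
  rw [B0]
  simp only [map_add, map_sub, map_neg, δ_num, δ_s, δ_r_pow, Derivation.map_one_eq_zero, δ_c]
  push_cast
  ring

lemma D2B0 : δ (δ (B 0)) =
      r ^ 3 - s := by
  rw [D1B0]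
  simp only [map_add, map_sub, map_neg, δ_num, δ_s, δ_r_pow, Derivation.map_one_eq_zero, δ_c]
  push_cast
  ring

lemma D3B0 : δ (δ (δ (B 0))) =
      3 * r ^ 5 - 3 * r ^ 3 + r ^ 1 - s := by
  rw [D2B0]
  simp only [map_add, map_sub, map_neg, δ_num, δ_s, δ_r_pow, Derivation.map_one_eq_zero, δ_c]
  push_cast
  ring

lemma D4B0 : δ (δ (δ (δ (B 0)))) =
      15 * r ^ 7 - 24 * r ^ 5 + 10 * r ^ 3 - s := by
  rw [D3B0]
  simp only [map_add, map_sub, map_neg, δ_num, δ_s, δ_r_pow, Derivation.map_one_eq_zero, δ_c]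
  push_cast
  ring

lemma D5B0 : δ (δ (δ (δ (δ (B 0))))) =
      105 * r ^ 9 - 225 * r ^ 7 + 150 * r ^ 5 - 30 * r ^ 3 + r ^ 1 - s := by
  rw [D4B0]
  simp only [map_add, map_sub, map_neg, δ_num, δ_s, δ_r_pow, Derivation.map_one_eq_zero, δ_c]
  push_cast
  ring

lemma B1 : B 1 =
      r ^ 2 - r ^ 1 - 1 + s := by
  have h := B_rec 1
  simp only [Finset.sum_range_succ, Finset.sum_range_zero, Function.iterate_succ_apply',
    Function.iterate_zero, id, Nat.reduceSub, Nat.reduceAdd, Nat.sub_zero, Nat.sub_self, D1B0] at h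
  simp only [B0] at h
  norm_num [Nat.choose] at h
  apply two_cancel
  linear_combination r * h + (-2) * r * s_sq - 2 * B 1 * rs +
    ((2) * r ^ 0 * s ^ 1 + (-2) * r ^ 0 * s ^ 0) * rs

lemma D1B1 : δ (B 1) =
      2 * r ^ 4 - r ^ 3 - 2 * r ^ 2 + s := by
  rw [B1]
  simp only [map_add, map_sub, map_neg, δ_num, δ_s, δ_r_pow, Derivation.map_one_eq_zero, δ_c]
  push_cast
  ring

lemma D2B1 : δ (δ (B 1)) =
      8 * r ^ 6 - 3 * r ^ 5 - 12 * r ^ 4 + 3 * r ^ 3 + 4 * r ^ 2 - r ^ 1 + s := by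
  rw [D1B1]
  simp only [map_add, map_sub, map_neg, δ_num, δ_s, δ_r_pow, Derivation.map_one_eq_zero, δ_c]
  push_cast
  ring

lemma D3B1 : δ (δ (δ (B 1))) =
      48 * r ^ 8 - 15 * r ^ 7 - 96 * r ^ 6 + 24 * r ^ 5 + 56 * r ^ 4 - 10 * r ^ 3
      - 8 * r ^ 2 + s := by
  rw [D2B1]
  simp only [map_add, map_sub, map_neg, δ_num, δ_s, δ_r_pow, Derivation.map_one_eq_zero, δ_c]
  push_cast
  ring

lemma D4B1 : δ (δ (δ (δ (B 1)))) =
      384 * r ^ 10 - 105 * r ^ 9 - 960 * r ^ 8 + 225 * r ^ 7 + 800 * r ^ 6 - 150 * r ^ 5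
      - 240 * r ^ 4 + 30 * r ^ 3 + 16 * r ^ 2 - r ^ 1 + s := by
  rw [D3B1]
  simp only [map_add, map_sub, map_neg, δ_num, δ_s, δ_r_pow, Derivation.map_one_eq_zero, δ_c]
  push_cast
  ring

lemma B2 : B 2 =
      5 * r ^ 5 - 5 * r ^ 4 - 5 * r ^ 3 + 4 * r ^ 2 + r ^ 1 + 1 - s := by
  have h := B_rec 2
  simp only [Finset.sum_range_succ, Finset.sum_range_zero, Function.iterate_succ_apply',
    Function.iterate_zero, id, Nat.reduceSub, Nat.reduceAdd, Nat.sub_zero, Nat.sub_self, D1B1, D2B0] at h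
  simp only [B0, B1] at h
  norm_num [Nat.choose] at h
  apply two_cancel
  linear_combination r * h + (4) * r * s_sq - 2 * B 2 * rs +
    ((4) * r ^ 2 * s ^ 0 + (-4) * r ^ 1 * s ^ 0 + (-2) * r ^ 0 * s ^ 1 + (2) * r ^ 0 * s ^ 0) * rs

lemma D1B2 : δ (B 2) =
      25 * r ^ 7 - 20 * r ^ 6 - 40 * r ^ 5 + 28 * r ^ 4 + 16 * r ^ 3 - 8 * r ^ 2 - s := by
  rw [B2]
  simp only [map_add, map_sub, map_neg, δ_num, δ_s, δ_r_pow, Derivation.map_one_eq_zero, δ_c]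
  push_cast
  ring

lemma D2B2 : δ (δ (B 2)) =
      175 * r ^ 9 - 120 * r ^ 8 - 375 * r ^ 7 + 232 * r ^ 6 + 248 * r ^ 5 - 128 * r ^ 4
      - 48 * r ^ 3 + 16 * r ^ 2 + r ^ 1 - s := by
  rw [D1B2]
  simp only [map_add, map_sub, map_neg, δ_num, δ_s, δ_r_pow, Derivation.map_one_eq_zero, δ_c]
  push_cast
  ring

lemma D3B2 : δ (δ (δ (B 2))) =
      1575 * r ^ 11 - 960 * r ^ 10 - 4200 * r ^ 9 + 2352 * r ^ 8 + 3865 * r ^ 7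
      - 1904 * r ^ 6 - 1384 * r ^ 5 + 544 * r ^ 4 + 145 * r ^ 3 - 32 * r ^ 2 - s := by
  rw [D2B2]
  simp only [map_add, map_sub, map_neg, δ_num, δ_s, δ_r_pow, Derivation.map_one_eq_zero, δ_c]
  push_cast
  ring

lemma B3 : B 3 =
      90 * r ^ 8 - 114 * r ^ 7 - 123 * r ^ 6 + 177 * r ^ 5 + 27 * r ^ 4 - 63 * r ^ 3
      + 7 * r ^ 2 - r ^ 1 - 1 + s := by
  have h := B_rec 3
  simp only [Finset.sum_range_succ, Finset.sum_range_zero, Function.iterate_succ_apply',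
    Function.iterate_zero, id, Nat.reduceSub, Nat.reduceAdd, Nat.sub_zero, Nat.sub_self, D1B2, D2B1, D3B0] at h
  simp only [B0, B1, B2] at h
  norm_num [Nat.choose] at h
  apply two_cancel
  linear_combination r * h + (-8) * r * s_sq - 2 * B 3 * rs +
    ((30) * r ^ 5 * s ^ 0 + (-30) * r ^ 4 * s ^ 0 + (-30) * r ^ 3 * s ^ 0 + (18) * r ^ 2 * s ^
      0 + (12) * r ^ 1 * s ^ 0 + (2) * r ^ 0 * s ^ 1 + (-2) * r ^ 0 * s ^ 0) * rs

lemma D1B3 : δ (B 3) =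
      720 * r ^ 10 - 798 * r ^ 9 - 1458 * r ^ 8 + 1683 * r ^ 7 + 846 * r ^ 6 - 1074 * r ^ 5
      - 94 * r ^ 4 + 188 * r ^ 3 - 14 * r ^ 2 + s := by
  rw [B3]
  simp only [map_add, map_sub, map_neg, δ_num, δ_s, δ_r_pow, Derivation.map_one_eq_zero, δ_c]
  push_cast
  ring

lemma D2B3 : δ (δ (B 3)) =
      7200 * r ^ 12 - 7182 * r ^ 11 - 18864 * r ^ 10 + 18963 * r ^ 9 + 16740 * r ^ 8
      - 17151 * r ^ 7 - 5452 * r ^ 6 + 5934 * r ^ 5 + 348 * r ^ 4 - 564 * r ^ 3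
      + 28 * r ^ 2 - r ^ 1 + s := by
  rw [D1B3]
  simp only [map_add, map_sub, map_neg, δ_num, δ_s, δ_r_pow, Derivation.map_one_eq_zero, δ_c]
  push_cast
  ring

lemma B4 : B 4 =
      3315 * r ^ 11 - 5208 * r ^ 10 - 5391 * r ^ 9 + 11193 * r ^ 8 + 1029 * r ^ 7
      - 7344 * r ^ 6 + 1454 * r ^ 5 + 1342 * r ^ 4 - 407 * r ^ 3 + 16 * r ^ 2 + r ^ 1
      + 1 - s := by
  have h := B_rec 4
  simp only [Finset.sum_range_succ, Finset.sum_range_zero, Function.iterate_succ_apply',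
    Function.iterate_zero, id, Nat.reduceSub, Nat.reduceAdd, Nat.sub_zero, Nat.sub_self, D1B3, D2B2, D3B1, D4B0] at h
  simp only [B0, B1, B2, B3] at h
  norm_num [Nat.choose] at h
  apply two_cancel
  linear_combination r * h + (16) * r * s_sq - 2 * B 4 * rs +
    ((720) * r ^ 8 * s ^ 0 + (-912) * r ^ 7 * s ^ 0 + (-984) * r ^ 6 * s ^ 0 + (1356) * r ^ 5 *
      s ^ 0 + (276) * r ^ 4 * s ^ 0 + (-444) * r ^ 3 * s ^ 0 + (16) * r ^ 2 * s ^ 0 + (-28) * r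
      ^ 1 * s ^ 0 + (-2) * r ^ 0 * s ^ 1 + (2) * r ^ 0 * s ^ 0) * rs

lemma D1B4 : δ (B 4) =
      36465 * r ^ 13 - 52080 * r ^ 12 - 84984 * r ^ 11 + 141624 * r ^ 10 + 55722 * r ^ 9
      - 133608 * r ^ 8 + 67 * r ^ 7 + 49432 * r ^ 6 - 8491 * r ^ 5 - 5336 * r ^ 4
      + 1222 * r ^ 3 - 32 * r ^ 2 - s := by
  rw [B4]
  simp only [map_add, map_sub, map_neg, δ_num, δ_s, δ_r_pow, Derivation.map_one_eq_zero, δ_c]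
  push_cast
  ring

lemma B5 : B 5 =
      203400 * r ^ 14 - 385215 * r ^ 13 - 359790 * r ^ 12 + 1035075 * r ^ 11 - 7305 * r ^ 10
      - 950415 * r ^ 9 + 309915 * r ^ 8 + 325455 * r ^ 7 - 167070 * r ^ 6
      - 22545 * r ^ 5 + 20820 * r ^ 4 - 2355 * r ^ 3 + 31 * r ^ 2 - r ^ 1 - 1 + s := by
  have h := B_rec 5
  simp only [Finset.sum_range_succ, Finset.sum_range_zero, Function.iterate_succ_apply',
    Function.iterate_zero, id, Nat.reduceSub, Nat.reduceAdd, Nat.sub_zero, Nat.sub_self, D1B4, D2B3, D3B2, D4B1, D5B0] at h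
  simp only [B0, B1, B2, B3, B4] at h
  norm_num [Nat.choose] at h
  apply two_cancel
  linear_combination r * h + (-32) * r * s_sq - 2 * B 5 * rs +
    ((33150) * r ^ 11 * s ^ 0 + (-52080) * r ^ 10 * s ^ 0 + (-53910) * r ^ 9 * s ^ 0 + (110130)
      * r ^ 8 * s ^ 0 + (12570) * r ^ 7 * s ^ 0 + (-70980) * r ^ 6 * s ^ 0 + (11100) * r ^ 5 * s
      ^ 0 + (12780) * r ^ 4 * s ^ 0 + (-2910) * r ^ 3 * s ^ 0 + (90) * r ^ 2 * s ^ 0 + (60) * r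
      ^ 1 * s ^ 0 + (2) * r ^ 0 * s ^ 1 + (-2) * r ^ 0 * s ^ 0) * rs

section

/-- Coefficients of powers of `r`. -/
noncomputable def a (j N : ℕ) : ℝ := coeff N (r ^ j)

lemma a_step (j N : ℕ) : j * a (j + 2) N = (j + 2 * N) * a j N := by
  have h := congrArg (coeff N) (δ_r_pow j)
  rw [coeff_δ, show (j : ℝ⟦X⟧) = C (j : ℝ) by simp, coeff_C_mul, map_sub] at h
  simp only [a]
  linear_combination -h

lemma coeff_s (N : ℕ) : (2 * N - 1) * coeff N s = - a 1 N := by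
  have h := congrArg (coeff N) δ_s
  rw [coeff_δ, map_sub] at h
  rw [a, pow_one]
  linear_combination h

lemma four_eq : (4 : ℝ⟦X⟧) = C 4 := (map_ofNat C 4).symm

lemma a_one_succ (N : ℕ) : (2 * N + 2) * a 1 (N + 1) = 4 * (2 * N + 1) * a 1 N := by
  have h1 : s = r - C 4 * (X * r) := by
    rw [← four_eq]
    linear_combination r * s_sq - s * rs
  have h := congrArg (coeff (N + 1)) h1
  rw [map_sub, coeff_C_mul, coeff_succ_X_mul] at h
  have h2 := coeff_s (N + 1)
  simp only [a, pow_one] at h2 ⊢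
  push_cast at h2
  rw [h] at h2
  linear_combination h2

lemma a_two_succ (N : ℕ) : a 2 (N + 1) = 4 * a 2 N := by
  have h1 : r ^ 2 - C 4 * (X * r ^ 2) = 1 := by
    rw [← four_eq]
    linear_combination -r ^ 2 * s_sq + (r * s + 1) * rs
  have h := congrArg (coeff (N + 1)) h1
  rw [map_sub, coeff_C_mul, coeff_succ_X_mul, coeff_one, if_neg (by omega)] at h
  simp only [a]
  linear_combination h

lemma coeff_zero_s : coeff 0 s = 1 := by
  rw [s, map_sub, coeff_B_zero]; simp

lemma a_one_zero : a 1 0 = 1 := by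
  have := coeff_s 0
  rw [coeff_zero_s] at this
  simpa using this.symm

lemma a_two_zero : a 2 0 = 1 := by
  have h := a_one_zero
  simp only [a, pow_one] at h ⊢
  simp only [coeff_zero_eq_constantCoeff] at h ⊢
  rw [map_pow, h, one_pow]

lemma a_one_pos (N : ℕ) : 0 < a 1 N := by
  induction N with
  | zero => rw [a_one_zero]; norm_num
  | succ N ih =>
    have h := a_one_succ N
    have h3 : 0 < (2 * (N : ℝ) + 2) * a 1 (N + 1) := by rw [h]; positivity
    exact (mul_pos_iff_of_pos_left (by positivity)).1 h3

lemma a_two_pos (N : ℕ) : 0 < a 2 N := by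
  induction N with
  | zero => rw [a_two_zero]; norm_num
  | succ N ih => rw [a_two_succ]; positivity

lemma ratio_sq (N : ℕ) : (a 2 N / a 1 N) ^ 2 = Real.Wallis.W N * (2 * N + 1) := by
  induction N with
  | zero => simp [a_one_zero, a_two_zero, Real.Wallis.W]
  | succ N ih =>
    have h : a 2 (N + 1) / a 1 (N + 1) = a 2 N / a 1 N * ((2 * N + 2) / (2 * N + 1)) := by
      have h1 := a_one_succ N
      have p1 := a_one_pos N
      have p2 := a_one_pos (N + 1)
      rw [a_two_succ]
      field_simp
      linear_combination -(a 2 N) * h1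
    rw [h, mul_pow, ih, Real.Wallis.W_succ]
    push_cast
    field_simp
    ring

lemma tendsto_inv_sqrt : Filter.Tendsto (fun N : ℕ => 1 / √(N : ℝ)) Filter.atTop (nhds 0) :=
  tendsto_const_nhds.div_atTop (Real.tendsto_sqrt_atTop.comp tendsto_natCast_atTop_atTop)

lemma ratio_lim : Filter.Tendsto (fun N : ℕ => a 2 N / (a 1 N * √(N : ℝ))) Filter.atTop
    (nhds (√Real.pi)) := by
  have h1 : Filter.Tendsto (fun N : ℕ => √(Real.Wallis.W N * (2 + (1 / √(N : ℝ)) ^ 2)))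
      Filter.atTop (nhds (√(Real.pi / 2 * (2 + 0 ^ 2)))) :=
    (Real.Wallis.tendsto_W_nhds_pi_div_two.mul ((tendsto_inv_sqrt.pow 2).const_add 2)).sqrt
  rw [show Real.pi / 2 * (2 + 0 ^ 2) = Real.pi by ring] at h1
  refine h1.congr' ?_
  filter_upwards [Filter.eventually_gt_atTop 0] with N hN
  have hN' : (0 : ℝ) < N := by exact_mod_cast hN
  have p1 := a_one_pos N
  have p2 := a_two_pos N
  rw [Real.sqrt_eq_iff_mul_self_eq (by have := Real.Wallis.W_pos N; positivity) (by positivity)]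
  have h := ratio_sq N
  have hs : √(N : ℝ) ^ 2 = N := Real.sq_sqrt hN'.le
  have e : a 2 N / (a 1 N * √(N : ℝ)) * (a 2 N / (a 1 N * √(N : ℝ))) =
      (a 2 N / a 1 N) ^ 2 / √(N : ℝ) ^ 2 := by
    field_simp
  rw [e, h, div_pow, hs]
  field_simp

/-- Limit constants. -/
noncomputable def lam : ℕ → ℝ
  | 0 => 1
  | 1 => √Real.pi
  | (j + 2) => lam j * (2 / (j + 1))

lemma a_lim : ∀ j : ℕ, Filter.Tendsto (fun N : ℕ => a (j + 1) N / (a 1 N * √(N : ℝ) ^ j))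
    Filter.atTop (nhds (lam j))
  | 0 => by
    have : (fun N : ℕ => a (0 + 1) N / (a 1 N * √(N : ℝ) ^ 0)) = fun _ => 1 := by
      ext N
      have := (a_one_pos N).ne'
      simp [this]
    rw [this, lam]
    exact tendsto_const_nhds
  | 1 => by simpa [lam] using ratio_lim
  | (j + 2) => by
    have h := (a_lim j).mul (((tendsto_inv_sqrt.pow 2).add_const (2 / ((j : ℝ) + 1))))
    rw [lam]
    rw [show (0 : ℝ) ^ 2 + 2 / ((j : ℝ) + 1) = 2 / (j + 1) by ring] at h
    refine h.congr' ?_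
    filter_upwards [Filter.eventually_gt_atTop 0] with N hN
    have hN' : (0 : ℝ) < N := by exact_mod_cast hN
    have p1 := a_one_pos N
    have hs : √(N : ℝ) ^ 2 = N := Real.sq_sqrt hN'.le
    have h2 := a_step (j + 1) N
    push_cast at h2
    have h3 : a (j + 2 + 1) N = (j + 1 + 2 * N) * a (j + 1) N / (j + 1) := by
      rw [eq_div_iff (by positivity)]
      linear_combination h2
    rw [h3, div_pow, hs, pow_add, hs]
    field_simp

lemma a_lim_zero (j d : ℕ) (h : j < d) :
    Filter.Tendsto (fun N : ℕ => a (j + 1) N / (a 1 N * √(N : ℝ) ^ d)) Filter.atTop (nhds 0) := by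
  have h1 := (a_lim j).mul (tendsto_inv_sqrt.pow (d - j))
  rw [zero_pow (by omega), mul_zero] at h1
  refine h1.congr fun N => ?_
  obtain ⟨e, rfl⟩ := Nat.exists_eq_add_of_lt h
  rw [show j + e + 1 - j = e + 1 by omega, show j + e + 1 = j + (e + 1) by ring, pow_add _ j]
  simp only [one_div, div_eq_mul_inv, mul_inv, inv_pow]
  ring

lemma sum_lim (c : ℕ → ℝ) (d : ℕ) :
    Filter.Tendsto (fun N : ℕ => (∑ j ∈ range (d + 1), c j * a (j + 1) N) / (a 1 N * √(N : ℝ) ^ d))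
      Filter.atTop (nhds (c d * lam d)) := by
  have h1 : Filter.Tendsto (fun N : ℕ => ∑ j ∈ range d, c j *
      (a (j + 1) N / (a 1 N * √(N : ℝ) ^ d))) Filter.atTop (nhds (∑ j ∈ range d, c j * 0)) :=
    tendsto_finsetSum _ fun j hj => (a_lim_zero j d (Finset.mem_range.1 hj)).const_mul _
  have h2 := h1.add ((a_lim d).const_mul (c d))
  simp only [mul_zero, Finset.sum_const_zero, zero_add] at h2
  refine h2.congr fun N => ?_
  rw [Finset.sum_range_succ, add_div, Finset.sum_div, mul_div_assoc]
  simp only [mul_div_assoc]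

/-- Raw moments. -/
noncomputable def M (k N : ℕ) : ℝ := coeff N (B k) / coeff N (B 0)

lemma coeff_B0 (N : ℕ) (hN : 0 < N) : coeff N (B 0) = - coeff N s := by
  rw [B0, map_sub, coeff_one, if_neg (by omega), zero_sub]

lemma M_lim (k : ℕ) (c : ℕ → ℝ) (ε : ℝ) (h : ∀ N, 0 < N → coeff N (B (k + 1)) =
      ∑ j ∈ range (3 * k + 1 + 1), c j * a (j + 1) N + ε * coeff N s) :
    Filter.Tendsto (fun N : ℕ => M (k + 1) N / √(N : ℝ) ^ (3 * (k + 1))) Filter.atTop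
      (nhds (2 * (c (3 * k + 1) * lam (3 * k + 1)))) := by
  have h1 := ((((tendsto_inv_sqrt.pow 2).const_sub 2)).mul (sum_lim c (3 * k + 1))).sub
    ((tendsto_inv_sqrt.pow (3 * (k + 1))).const_mul ε)
  rw [zero_pow (by omega), zero_pow (by omega), mul_zero, sub_zero, sub_zero] at h1
  refine h1.congr' ?_
  filter_upwards [Filter.eventually_gt_atTop 0] with N hN
  have hN' : (1 : ℝ) ≤ N := by exact_mod_cast hN
  have p1 := a_one_pos N
  have hs : √(N : ℝ) ^ 2 = N := Real.sq_sqrt (by linarith)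
  have hs0 : 0 < √(N : ℝ) := Real.sqrt_pos.2 (by linarith)
  have h2 := coeff_s N
  have h4 : 0 < 2 * (N : ℝ) - 1 := by linarith
  have h3 : coeff N s = - a 1 N / (2 * N - 1) := by
    rw [eq_div_iff h4.ne']; linear_combination h2
  rw [M, h N hN, coeff_B0 N hN, h3]
  generalize ∑ j ∈ range (3 * k + 1 + 1), c j * a (j + 1) N = Z
  rw [show 3 * (k + 1) = 3 * k + 1 + 2 by ring]
  simp only [div_pow, one_pow]
  rw [pow_add _ (3 * k + 1) 2, hs]
  have hp : √(N : ℝ) ^ (3 * k + 1) ≠ 0 := by positivity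
  generalize √(N : ℝ) ^ (3 * k + 1) = y at hp ⊢
  field_simp
  ring


lemma coeff_num (n : ℕ) [n.AtLeastTwo] (f : ℝ⟦X⟧) (N : ℕ) :
    coeff N (ofNat(n) * f) = ofNat(n) * coeff N f := by
  rw [show (ofNat(n) : ℝ⟦X⟧) = C (ofNat(n) : ℝ) from (map_ofNat C n).symm, coeff_C_mul]

lemma M1_lim : Filter.Tendsto (fun N : ℕ => M 1 N / √(N : ℝ) ^ 3) Filter.atTop
    (nhds (2 * √Real.pi)) := by
  have h := M_lim 0 (fun j => ([-1, 1] : List ℝ).getD j 0) (1) (by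
    intro N hN
    have h1 : coeff N (1 : ℝ⟦X⟧) = 0 := by rw [coeff_one, if_neg (by omega)]
    rw [B1]
    simp [Finset.sum_range_succ, a, coeff_num, h1]
    try ring)
  convert h using 2
  simp [lam]
  try ring

lemma M2_lim : Filter.Tendsto (fun N : ℕ => M 2 N / √(N : ℝ) ^ 6) Filter.atTop
    (nhds (40 / 3)) := by
  have h := M_lim 1 (fun j => ([1, 4, -5, -5, 5] : List ℝ).getD j 0) (-1) (by
    intro N hN
    have h1 : coeff N (1 : ℝ⟦X⟧) = 0 := by rw [coeff_one, if_neg (by omega)]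
    rw [B2]
    simp [Finset.sum_range_succ, a, coeff_num, h1]
    try ring)
  convert h using 2
  simp [lam]
  try ring

lemma M3_lim : Filter.Tendsto (fun N : ℕ => M 3 N / √(N : ℝ) ^ 9) Filter.atTop
    (nhds (30 * √Real.pi)) := by
  have h := M_lim 2 (fun j => ([-1, 7, -63, 27, 177, -123, -114, 90] : List ℝ).getD j 0) (1) (by
    intro N hN
    have h1 : coeff N (1 : ℝ⟦X⟧) = 0 := by rw [coeff_one, if_neg (by omega)]
    rw [B3]
    simp [Finset.sum_range_succ, a, coeff_num, h1]
    try ring)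
  convert h using 2
  simp [lam]
  try ring

lemma M4_lim : Filter.Tendsto (fun N : ℕ => M 4 N / √(N : ℝ) ^ 12) Filter.atTop
    (nhds (14144 / 63)) := by
  have h := M_lim 3 (fun j => ([1, 16, -407, 1342, 1454, -7344, 1029, 11193, -5391, -5208, 3315] : List ℝ).getD j 0) (-1) (by
    intro N hN
    have h1 : coeff N (1 : ℝ⟦X⟧) = 0 := by rw [coeff_one, if_neg (by omega)]
    rw [B4]
    simp [Finset.sum_range_succ, a, coeff_num, h1]
    try ring)
  convert h using 2
  simp [lam]
  try ring

lemma M5_lim : Filter.Tendsto (fun N : ℕ => M 5 N / √(N : ℝ) ^ 15) Filter.atTop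
    (nhds (565 * √Real.pi)) := by
  have h := M_lim 4 (fun j => ([-1, 31, -2355, 20820, -22545, -167070, 325455, 309915, -950415, -7305, 1035075, -359790, -385215, 203400] : List ℝ).getD j 0) (1) (by
    intro N hN
    have h1 : coeff N (1 : ℝ⟦X⟧) = 0 := by rw [coeff_one, if_neg (by omega)]
    rw [B5]
    simp [Finset.sum_range_succ, a, coeff_num, h1]
    try ring)
  convert h using 2
  simp [lam]
  try ring

end

end TotH

namespace TotH

open BinaryTree Finset

lemma S_zero_pos (n : ℕ) : 0 < S 0 n := by
  have h : S 0 n = ((treesOfNumNodesEq n).card : ℝ) := by simp [S]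
  rw [h]
  have : treesOfNumNodesEq n ≠ ∅ := by
    intro h0
    have h1 := treesOfNumNodesEq_card_eq_catalan n
    rw [h0, Finset.card_empty] at h1
    have h2 := succ_mul_catalan_eq_centralBinom n
    rw [← h1, mul_zero] at h2
    exact Nat.centralBinom_ne_zero n h2.symm
  exact_mod_cast Finset.card_pos.2 (Finset.nonempty_iff_ne_empty.2 this)

lemma M_succ (k n : ℕ) : M k (n + 1) = S k n / S 0 n := by
  rw [M, coeff_B_succ, coeff_B_succ]
  have := S_zero_pos n
  field_simp

lemma central (n i : ℕ) (c : ℝ) :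
    (∑ t ∈ treesOfNumNodesEq n, (K t - c) ^ i) / S 0 n =
      ∑ j ∈ range (i + 1), M j (n + 1) * (-c) ^ (i - j) * (i.choose j : ℝ) := by
  have : ∀ t ∈ treesOfNumNodesEq n, (K t - c) ^ i =
      ∑ j ∈ range (i + 1), K t ^ j * (-c) ^ (i - j) * (i.choose j : ℝ) := by
    intro t _
    rw [sub_eq_add_neg, add_pow]
  rw [Finset.sum_congr rfl this, Finset.sum_comm, Finset.sum_div]
  refine Finset.sum_congr rfl fun j _ => ?_
  rw [M_succ, ← Finset.sum_mul, ← Finset.sum_mul, ← S]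
  ring

lemma M_zero (n : ℕ) : M 0 (n + 1) = 1 := by
  rw [M_succ, div_self (S_zero_pos n).ne']

lemma m2_lim : Filter.Tendsto (fun N : ℕ => (M 2 N - M 1 N ^ 2) / √(N : ℝ) ^ 6) Filter.atTop
    (nhds (4 / 3 * (10 - 3 * Real.pi))) := by
  have h := M2_lim.sub (M1_lim.pow 2)
  have e : (40 / 3 : ℝ) - (2 * √Real.pi) ^ 2 = 4 / 3 * (10 - 3 * Real.pi) := by
    rw [mul_pow, Real.sq_sqrt Real.pi_pos.le]; ring
  rw [e] at h
  refine h.congr fun N => ?_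
  rw [div_pow, ← pow_mul, sub_div]

lemma m5_lim : Filter.Tendsto (fun N : ℕ => (M 5 N - 5 * M 4 N * M 1 N + 10 * M 3 N * M 1 N ^ 2
      - 10 * M 2 N * M 1 N ^ 3 + 4 * M 1 N ^ 5) / √(N : ℝ) ^ 15) Filter.atTop
    (nhds (√Real.pi * (128 * Real.pi ^ 2 + 400 / 3 * Real.pi - 105845 / 63))) := by
  have h := (((M5_lim.sub ((M4_lim.mul M1_lim).const_mul 5)).add
    ((M3_lim.mul (M1_lim.pow 2)).const_mul 10)).sub
    ((M2_lim.mul (M1_lim.pow 3)).const_mul 10)).add ((M1_lim.pow 5).const_mul 4)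
  refine (h.congr' ?_).trans_eq ?_
  · filter_upwards [Filter.eventually_gt_atTop 0] with N hN
    have hs0 : 0 < √(N : ℝ) := Real.sqrt_pos.2 (by exact_mod_cast hN)
    field_simp
  · congr 1
    have hp : √Real.pi ^ 2 = Real.pi := Real.sq_sqrt Real.pi_pos.le
    generalize √Real.pi = y at hp ⊢
    rw [← hp]
    ring

lemma final_const : √Real.pi * (128 * Real.pi ^ 2 + 400 / 3 * Real.pi - 105845 / 63) /
      (4 / 3 * (10 - 3 * Real.pi)) ^ ((5 : ℝ) / 2) =
    (36 * Real.pi ^ 2 + (75 / 2) * Real.pi - 105845 / 224) * Real.sqrt 3 *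
      Real.sqrt (Real.pi / (10 - 3 * Real.pi)) / (10 - 3 * Real.pi) ^ 2 := by
  have hx : 0 < 10 - 3 * Real.pi := by linarith [Real.pi_lt_d2]
  generalize hz : 128 * Real.pi ^ 2 + 400 / 3 * Real.pi - 105845 / 63 = z
  have hz2 : 36 * Real.pi ^ 2 + (75 / 2) * Real.pi - 105845 / 224 = 9 / 32 * z := by
    rw [← hz]; ring
  rw [hz2, Real.sqrt_div Real.pi_pos.le]
  generalize 10 - 3 * Real.pi = x at hx ⊢
  have h52 : (4 / 3 * x) ^ ((5 : ℝ) / 2) = (4 / 3 * x) ^ 2 * (2 / √3 * √x) := by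
    rw [show (5 : ℝ) / 2 = (2 : ℕ) + 1 / 2 by norm_num, Real.rpow_add (by positivity),
      Real.rpow_natCast, ← Real.sqrt_eq_rpow, Real.sqrt_mul (by positivity),
      Real.sqrt_div (by positivity), show (4 : ℝ) = 2 ^ 2 by norm_num,
      Real.sqrt_sq (by norm_num)]
  rw [h52]
  have : 0 < √x := Real.sqrt_pos.2 hx
  field_simp
  ring

end TotH

open Filter Real

/-- Let `H_n` be the total height (sum over all vertices of the distance to the root) on
complete binary trees with `2n+1` vertices, under the uniform distribution; with mean
`μ n`, central moments `m i n`, and scaled moments `α i n = m i n / (m 2 n)^(i/2)`,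
the `5`-th scaled moment converges as `n → ∞` to the stated constant. -/
theorem totalheight_stmt9 (T : ℕ → Finset PTree)
    (hT : ∀ n : ℕ, ∀ t : PTree, t ∈ T n ↔ t.size = 2 * n + 1 ∧ t.validDeg {2})
    (μ : ℕ → ℝ)
    (hμ : ∀ n : ℕ, μ n = (∑ t ∈ T n, (t.totalHeight : ℝ)) / ((T n).card : ℝ))
    (m : ℕ → ℕ → ℝ)
    (hm : ∀ i n : ℕ, m i n =
      (∑ t ∈ T n, ((t.totalHeight : ℝ) - μ n) ^ i) / ((T n).card : ℝ))
    (α : ℕ → ℕ → ℝ)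
    (hα : ∀ i n : ℕ, α i n = m i n / (m 2 n) ^ ((i : ℝ) / 2)) :
    Tendsto (fun n : ℕ => α 5 n) atTop
      (nhds ((36 * π ^ 2 + (75 / 2) * π - 105845 / 224) * Real.sqrt 3 * Real.sqrt (π / (10 - 3 * π)) / (10 - 3 * π) ^ 2)) := by
  have hcard : ∀ n, ((T n).card : ℝ) = TotH.S 0 n := by
    intro n
    rw [TotH.T_eq T hT n, Finset.card_map]
    simp [TotH.S]
  have hsum : ∀ n (f : ℝ → ℝ), ∑ t ∈ T n, f (t.totalHeight : ℝ) =
      ∑ t ∈ BinaryTree.treesOfNumNodesEq n, f (TotH.K t - 2 * n) := by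
    intro n f
    rw [TotH.T_eq T hT n, Finset.sum_map]
    refine Finset.sum_congr rfl fun t ht => ?_
    rw [Function.Embedding.coeFn_mk, TotH.totalHeight_toP, BinaryTree.mem_treesOfNumNodesEq.1 ht]
  have hmu : ∀ n, μ n = TotH.M 1 (n + 1) - 2 * n := by
    intro n
    rw [hμ, hcard, hsum n (fun x => x)]
    have h := TotH.central n 1 (2 * n)
    simp only [pow_one] at h
    rw [h]
    simp [Finset.sum_range_succ, TotH.M_zero]
    ring
  have hmm : ∀ i n, m i n = ∑ j ∈ Finset.range (i + 1),
      TotH.M j (n + 1) * (-TotH.M 1 (n + 1)) ^ (i - j) * (i.choose j : ℝ) := by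
    intro i n
    rw [hm, hcard, hsum n (fun x => (x - μ n) ^ i), ← TotH.central]
    congr 1
    refine Finset.sum_congr rfl fun t _ => ?_
    rw [hmu]; congr 1; ring
  have hm2 : ∀ n, m 2 n = TotH.M 2 (n + 1) - TotH.M 1 (n + 1) ^ 2 := by
    intro n
    rw [hmm]
    simp [Finset.sum_range_succ, TotH.M_zero]
    ring
  have hm5 : ∀ n, m 5 n = TotH.M 5 (n + 1) - 5 * TotH.M 4 (n + 1) * TotH.M 1 (n + 1) +
      10 * TotH.M 3 (n + 1) * TotH.M 1 (n + 1) ^ 2 -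
      10 * TotH.M 2 (n + 1) * TotH.M 1 (n + 1) ^ 3 + 4 * TotH.M 1 (n + 1) ^ 5 := by
    intro n
    rw [hmm]
    simp [Finset.sum_range_succ, TotH.M_zero, Nat.choose]
    ring
  have hx : 0 < 10 - 3 * π := by linarith [Real.pi_lt_d2]
  have l2 := (tendsto_add_atTop_iff_nat 1).2 TotH.m2_lim
  have l5 := (tendsto_add_atTop_iff_nat 1).2 TotH.m5_lim
  have hl := l5.div (l2.rpow_const (p := (5 : ℝ) / 2) (Or.inl (by positivity))) (by positivity)
  rw [TotH.final_const] at hl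
  refine hl.congr fun n => ?_
  rw [hα]
  have hs : 0 < √((n + 1 : ℕ) : ℝ) := Real.sqrt_pos.2 (by positivity)
  have h2 : 0 ≤ m 2 n := by
    rw [hm]
    exact div_nonneg (Finset.sum_nonneg fun t _ => sq_nonneg _) (Nat.cast_nonneg _)
  have e : (√((n + 1 : ℕ) : ℝ) ^ 6) ^ ((5 : ℝ) / 2) = √((n + 1 : ℕ) : ℝ) ^ 15 := by
    rw [← Real.rpow_natCast, ← Real.rpow_natCast, ← Real.rpow_mul hs.le]
    norm_num
  simp only [Pi.div_apply]
  rw [← hm2, ← hm5, Real.div_rpow h2 (by positivity), e, div_div_div_cancel_right₀ (by positivity)]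
  norm_num
end
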